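/- Let Γ be a non-uniform lattice in G = SL(2,ℝ) and let x₀ ∈ Γ\G be such that the orbit x₀H = {x₀h(s) : s ∈ ℝ} is closed and non-compact in Γ\G. Then for every continuous compactly supported function ψ on Γ\G, (1/(2|T|)) ∫_{−∞}^{∞} ψ(x₀h(s)a(T)) ds → ∫_{Γ\G} ψ dμ as T → +∞ and also as T → −∞. -/

import Mathlib

noncomputable section
open MeasureTheory Matrix Filter Topology

abbrev SL2 : Type := Matrix.SpecialLinearGroup (Fin 2) ℝ

instance : TopologicalSpace SL2 :=
  TopologicalSpace.induced (fun g : SL2 => (g : Matrix (Fin 2) (Fin 2) ℝ)) inferInstance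

instance : MeasurableSpace SL2 := borel SL2

/-- `h(s) = [[cosh(s/2), sinh(s/2)], [sinh(s/2), cosh(s/2)]]` -/
def hmat (s : ℝ) : SL2 :=
  ⟨!![Real.cosh (s/2), Real.sinh (s/2); Real.sinh (s/2), Real.cosh (s/2)], by
    rw [Matrix.det_fin_two_of]
    nlinarith [Real.cosh_sq_sub_sinh_sq (s/2)]⟩

/-- `a(t) = [[e^{t/2}, 0], [0, e^{-t/2}]]` -/
def amat (t : ℝ) : SL2 :=
  ⟨!![Real.exp (t/2), 0; 0, Real.exp (-(t/2))], by
    rw [Matrix.det_fin_two_of]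
    rw [← Real.exp_add]
    simp⟩

/-- the quotient `Γ\G` by right cosets `Γg` -/
def XQuot (Γ : Subgroup SL2) : Type := Quotient (QuotientGroup.rightRel Γ)

instance (Γ : Subgroup SL2) : TopologicalSpace (XQuot Γ) :=
  inferInstanceAs (TopologicalSpace (Quotient (QuotientGroup.rightRel Γ)))

instance (Γ : Subgroup SL2) : MeasurableSpace (XQuot Γ) := borel (XQuot Γ)

/-- the natural projection `G → Γ\G`, `g ↦ Γg` -/
def qmk (Γ : Subgroup SL2) (g : SL2) : XQuot Γ := Quotient.mk (QuotientGroup.rightRel Γ) g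

/-- the right action of `G` on `Γ\G`: `(Γg)g' = Γgg'`. -/
def rmul (Γ : Subgroup SL2) (x : XQuot Γ) (g : SL2) : XQuot Γ :=
  Quotient.map' (fun h => h * g)
    (fun a b hab => by
      rw [QuotientGroup.rightRel_apply] at hab ⊢
      simpa [mul_assoc] using hab) x

/-- `Γ` is a lattice in `SL(2,ℝ)`: a discrete subgroup of finite covolume. -/
def IsLatticeSL2 (Γ : Subgroup SL2) : Prop :=
  DiscreteTopology Γ ∧
    ∃ μG : Measure SL2, μG.IsHaarMeasure ∧
      ∃ F : Set SL2, IsFundamentalDomain Γ F μG ∧ μG F ≠ ⊤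

/-- a function on `Γ\G` is smooth iff its lift to `G ⊆ M₂(ℝ) = ℝ⁴` extends to a smooth
function on the ambient matrix space (equivalently, it is smooth on the manifold `Γ\G`). -/
def IsSmoothQuot (Γ : Subgroup SL2) (ψ : XQuot Γ → ℝ) : Prop :=
  ∃ Ψ : (Fin 2 → Fin 2 → ℝ) → ℝ, ContDiff ℝ (⊤ : ℕ∞) Ψ ∧
    ∀ g : SL2, ψ (qmk Γ g) = Ψ (fun i j => (g : Matrix (Fin 2) (Fin 2) ℝ) i j)

section SL2Topology

theorem SL2.isEmbedding_coe :
    IsEmbedding (fun g : SL2 => (g : Matrix (Fin 2) (Fin 2) ℝ)) :=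
  ⟨⟨rfl⟩, Subtype.val_injective⟩

theorem SL2.isClosedEmbedding_coe :
    IsClosedEmbedding (fun g : SL2 => (g : Matrix (Fin 2) (Fin 2) ℝ)) := by
  refine ⟨SL2.isEmbedding_coe, ?_⟩
  have : Set.range (fun g : SL2 => (g : Matrix (Fin 2) (Fin 2) ℝ)) = {A | A.det = 1} := by
    ext A
    exact ⟨fun ⟨g, hg⟩ => hg ▸ g.2, fun h => ⟨⟨A, h⟩, rfl⟩⟩
  rw [this]
  exact isClosed_eq (continuous_id.matrix_det) continuous_const

instance : IsTopologicalGroup SL2 where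
  continuous_mul := by
    rw [SL2.isEmbedding_coe.continuous_iff]
    exact (SL2.isEmbedding_coe.continuous.comp continuous_fst).matrix_mul
      (SL2.isEmbedding_coe.continuous.comp continuous_snd)
  continuous_inv := by
    rw [SL2.isEmbedding_coe.continuous_iff]
    have : ((fun g : SL2 => (g : Matrix (Fin 2) (Fin 2) ℝ)) ∘ fun g => g⁻¹) =
        fun g : SL2 => (g : Matrix (Fin 2) (Fin 2) ℝ).adjugate := by
      ext g : 1
      exact Matrix.SpecialLinearGroup.coe_inv g
    rw [this]
    exact SL2.isEmbedding_coe.continuous.matrix_adjugate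

instance : T2Space SL2 := SL2.isEmbedding_coe.t2Space

instance : SecondCountableTopology SL2 :=
  haveI : SecondCountableTopology (Matrix (Fin 2) (Fin 2) ℝ) :=
    inferInstanceAs (SecondCountableTopology (Fin 2 → Fin 2 → ℝ))
  SL2.isEmbedding_coe.isInducing.secondCountableTopology

instance : LocallyCompactSpace SL2 :=
  haveI : LocallyCompactSpace (Matrix (Fin 2) (Fin 2) ℝ) :=
    inferInstanceAs (LocallyCompactSpace (Fin 2 → Fin 2 → ℝ))
  SL2.isClosedEmbedding_coe.locallyCompactSpace

instance : BorelSpace SL2 := ⟨rfl⟩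

theorem SL2.continuous_entry (i j : Fin 2) :
    Continuous fun g : SL2 => (g : Matrix (Fin 2) (Fin 2) ℝ) i j :=
  SL2.isEmbedding_coe.continuous.matrix_elem i j

theorem SL2.continuous_iff_entry {α : Type*} [TopologicalSpace α] {f : α → SL2} :
    Continuous f ↔ ∀ i j, Continuous fun x => (f x : Matrix (Fin 2) (Fin 2) ℝ) i j := by
  rw [SL2.isEmbedding_coe.continuous_iff]
  exact ⟨fun h i j => h.matrix_elem i j, fun h => continuous_matrix h⟩

/-- The sum of the absolute values of the entries of `g - 1`. -/
def SL2.dev (g : SL2) : ℝ :=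
  |(g : Matrix (Fin 2) (Fin 2) ℝ) 0 0 - 1| + |(g : Matrix (Fin 2) (Fin 2) ℝ) 0 1| +
    |(g : Matrix (Fin 2) (Fin 2) ℝ) 1 0| + |(g : Matrix (Fin 2) (Fin 2) ℝ) 1 1 - 1|

theorem SL2.dev_one : SL2.dev 1 = 0 := by simp [SL2.dev]

theorem SL2.continuous_dev : Continuous SL2.dev := by
  unfold SL2.dev
  have := SL2.continuous_entry
  fun_prop

theorem SL2.exists_dev_lt_of_mem_nhds {Ω : Set SL2} (hΩ : Ω ∈ 𝓝 (1 : SL2)) :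
    ∃ ε > 0, ∀ g : SL2, SL2.dev g < ε → g ∈ Ω := by
  rw [SL2.isEmbedding_coe.nhds_eq_comap, mem_comap] at hΩ
  obtain ⟨U, hU, hUΩ⟩ := hΩ
  obtain ⟨ε, hε, hball⟩ := (Metric.mem_nhds_iff (α := Fin 2 → Fin 2 → ℝ)).1 hU
  refine ⟨ε, hε, fun g hg => hUΩ (@hball (g : Matrix (Fin 2) (Fin 2) ℝ) ?_)⟩
  have h0 := abs_nonneg ((g : Matrix (Fin 2) (Fin 2) ℝ) 0 0 - 1)
  have h1 := abs_nonneg ((g : Matrix (Fin 2) (Fin 2) ℝ) 0 1)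
  have h2 := abs_nonneg ((g : Matrix (Fin 2) (Fin 2) ℝ) 1 0)
  have h3 := abs_nonneg ((g : Matrix (Fin 2) (Fin 2) ℝ) 1 1 - 1)
  unfold SL2.dev at hg
  refine (dist_pi_lt_iff hε).2 fun i => (dist_pi_lt_iff hε).2 fun j => ?_
  rw [Real.dist_eq]
  change |(g : Matrix (Fin 2) (Fin 2) ℝ) i j - (1 : Matrix (Fin 2) (Fin 2) ℝ) i j| < ε
  fin_cases i <;> fin_cases j <;> simp <;> linarith

theorem SL2.setOf_dev_lt_mem_nhds {ε : ℝ} (hε : 0 < ε) : {g | SL2.dev g < ε} ∈ 𝓝 (1 : SL2) :=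
  (isOpen_lt SL2.continuous_dev continuous_const).mem_nhds (by simpa [SL2.dev_one] using hε)

end SL2Topology

section Quotient

variable {Γ : Subgroup SL2}

theorem rmul_qmk (g h : SL2) : rmul Γ (qmk Γ g) h = qmk Γ (g * h) := rfl

theorem qmk_surjective : Function.Surjective (qmk Γ) := Quotient.mk_surjective

theorem rmul_rmul (x : XQuot Γ) (g h : SL2) : rmul Γ (rmul Γ x g) h = rmul Γ x (g * h) := by
  obtain ⟨k, rfl⟩ := qmk_surjective x
  simp [rmul_qmk, mul_assoc]

theorem rmul_one (x : XQuot Γ) : rmul Γ x 1 = x := by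
  obtain ⟨k, rfl⟩ := qmk_surjective x
  simp [rmul_qmk]

theorem exists_rmul_eq (x y : XQuot Γ) : ∃ g, rmul Γ x g = y := by
  obtain ⟨k, rfl⟩ := qmk_surjective x
  obtain ⟨l, rfl⟩ := qmk_surjective y
  exact ⟨k⁻¹ * l, by simp [rmul_qmk]⟩

theorem qmk_eq_iff (g h : SL2) : qmk Γ g = qmk Γ h ↔ h * g⁻¹ ∈ Γ := by
  rw [← QuotientGroup.rightRel_apply]
  exact Quotient.eq

theorem rmul_injective_left (g : SL2) : Function.Injective fun x => rmul Γ x g := fun x y h => by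
  have := congrArg (fun z => rmul Γ z g⁻¹) h
  simpa [rmul_rmul, rmul_one] using this

theorem isOpenQuotientMap_qmk : IsOpenQuotientMap (qmk Γ) :=
  ⟨qmk_surjective, continuous_quot_mk, isOpenMap_quotient_mk'_mul (Γ := Γ) (T := SL2)⟩

theorem continuous_rmul : Continuous fun p : XQuot Γ × SL2 => rmul Γ p.1 p.2 := by
  rw [(isOpenQuotientMap_qmk.prodMap
    (IsOpenQuotientMap.id (X := SL2))).isQuotientMap.continuous_iff]
  exact isOpenQuotientMap_qmk.continuous.comp continuous_mul

instance : LocallyCompactSpace (XQuot Γ) := isOpenQuotientMap_qmk.locallyCompactSpace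

instance : SecondCountableTopology (XQuot Γ) :=
  ContinuousConstSMul.secondCountableTopology (Γ := Γ) (T := SL2)

instance : BorelSpace (XQuot Γ) := ⟨rfl⟩

theorem t2Space_xQuot [DiscreteTopology Γ] : T2Space (XQuot Γ) := by
  have : ProperlyDiscontinuousSMul Γ SL2 :=
    Γ.properlyDiscontinuousSMul_of_tendsto_cofinite (Γ.tendsto_coe_cofinite_of_discrete ⟨‹_›⟩)
  exact inferInstanceAs (T2Space (Quotient (MulAction.orbitRel Γ SL2)))

theorem eventually_eq_one_of_rmul_eq [DiscreteTopology Γ] (x : XQuot Γ) :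
    ∀ᶠ p : XQuot Γ × SL2 in 𝓝 x ×ˢ 𝓝 1, rmul Γ p.1 p.2 = p.1 → p.2 = 1 := by
  obtain ⟨g₀, rfl⟩ := qmk_surjective x
  obtain ⟨U, hU, hUΓ⟩ := mem_nhds_induced (Subtype.val : Γ → SL2) 1 {1} |>.1
    (by rw [← instTopologicalSpaceSubtype]; exact isOpen_discrete _ |>.mem_nhds rfl)
  have hc : ∀ᶠ p : SL2 × SL2 in 𝓝 g₀ ×ˢ 𝓝 1, p.1 * p.2 * p.1⁻¹ ∈ U := by
    rw [← nhds_prod_eq]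
    have : Continuous fun p : SL2 × SL2 => p.1 * p.2 * p.1⁻¹ := by fun_prop
    exact this.continuousAt.preimage_mem_nhds (by simpa using hU)
  rw [← isOpenQuotientMap_qmk.map_nhds_eq, Filter.prod_map_left, eventually_map]
  filter_upwards [hc] with p hp h
  have hΓ : p.1 * p.2 * p.1⁻¹ ∈ Γ := (qmk_eq_iff p.1 (p.1 * p.2)).1 h.symm
  have h1 : p.1 * p.2 * p.1⁻¹ = 1 := congrArg Subtype.val (@hUΓ ⟨_, hΓ⟩ hp)
  rw [mul_inv_eq_one] at h1
  exact mul_left_cancel (h1.trans (mul_one _).symm)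

end Quotient

section Commutators

/-- The entrywise `ℓ¹` norm of a matrix. -/
def entryNorm (A : Matrix (Fin 2) (Fin 2) ℝ) : ℝ := |A 0 0| + |A 0 1| + |A 1 0| + |A 1 1|

theorem entryNorm_nonneg (A : Matrix (Fin 2) (Fin 2) ℝ) : 0 ≤ entryNorm A := by
  unfold entryNorm; positivity

theorem entryNorm_mul_le (A B : Matrix (Fin 2) (Fin 2) ℝ) :
    entryNorm (A * B) ≤ entryNorm A * entryNorm B := by
  have key (a b c d : ℝ) : |a * b + c * d| ≤ |a| * |b| + |c| * |d| := by
    rw [← abs_mul, ← abs_mul]; exact abs_add_le _ _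
  simp only [entryNorm, Matrix.mul_apply, Fin.sum_univ_two]
  have h1 := key (A 0 0) (B 0 0) (A 0 1) (B 1 0)
  have h2 := key (A 0 0) (B 0 1) (A 0 1) (B 1 1)
  have h3 := key (A 1 0) (B 0 0) (A 1 1) (B 1 0)
  have h4 := key (A 1 0) (B 0 1) (A 1 1) (B 1 1)
  have h5 : 0 ≤ |A 0 0| * (|B 1 0| + |B 1 1|) + |A 0 1| * (|B 0 0| + |B 0 1|) +
      |A 1 0| * (|B 1 0| + |B 1 1|) + |A 1 1| * (|B 0 0| + |B 0 1|) := by positivity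
  linarith

theorem entryNorm_add_le (A B : Matrix (Fin 2) (Fin 2) ℝ) :
    entryNorm (A + B) ≤ entryNorm A + entryNorm B := by
  simp only [entryNorm, Matrix.add_apply]
  linarith [abs_add_le (A 0 0) (B 0 0), abs_add_le (A 0 1) (B 0 1), abs_add_le (A 1 0) (B 1 0),
    abs_add_le (A 1 1) (B 1 1)]

theorem entryNorm_neg (A : Matrix (Fin 2) (Fin 2) ℝ) : entryNorm (-A) = entryNorm A := by
  simp [entryNorm]

theorem SL2.dev_eq (g : SL2) : SL2.dev g = entryNorm ((g : Matrix (Fin 2) (Fin 2) ℝ) - 1) := by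
  simp [SL2.dev, entryNorm]

theorem SL2.dev_nonneg (g : SL2) : 0 ≤ SL2.dev g := SL2.dev_eq g ▸ entryNorm_nonneg _

theorem SL2.entryNorm_inv (g : SL2) :
    entryNorm ((g⁻¹ : SL2) : Matrix (Fin 2) (Fin 2) ℝ) =
      entryNorm (g : Matrix (Fin 2) (Fin 2) ℝ) := by
  rw [Matrix.SpecialLinearGroup.coe_inv, Matrix.adjugate_fin_two]
  simp only [entryNorm, Matrix.of_apply, Matrix.cons_val', Matrix.cons_val_zero,
    Matrix.cons_val_one, Matrix.cons_val_fin_one, abs_neg]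
  ring

theorem SL2.entryNorm_le (g : SL2) : entryNorm (g : Matrix (Fin 2) (Fin 2) ℝ) ≤ 2 + SL2.dev g := by
  have := entryNorm_add_le ((g : Matrix (Fin 2) (Fin 2) ℝ) - 1) 1
  rw [sub_add_cancel, ← SL2.dev_eq] at this
  have h1 : entryNorm (1 : Matrix (Fin 2) (Fin 2) ℝ) = 2 := by simp [entryNorm]; norm_num
  linarith

theorem SL2.dev_commutator_le {g h : SL2} (hg : SL2.dev g ≤ 1 / 40) (hh : SL2.dev h ≤ 1 / 40) :
    SL2.dev (g * h * g⁻¹ * h⁻¹) ≤ SL2.dev g / 2 := by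
  set M : Matrix (Fin 2) (Fin 2) ℝ := (g : Matrix (Fin 2) (Fin 2) ℝ) - 1 with hM
  set D : Matrix (Fin 2) (Fin 2) ℝ := (h : Matrix (Fin 2) (Fin 2) ℝ) - 1 with hD
  have hcomm : ((g * h * g⁻¹ * h⁻¹ : SL2) : Matrix (Fin 2) (Fin 2) ℝ) - 1 =
      (M * D + -(D * M)) * ((h * g)⁻¹ : SL2) := by
    have h1 : M * D + -(D * M) = ((g * h : SL2) : Matrix (Fin 2) (Fin 2) ℝ) - (h * g : SL2) := by
      rw [hM, hD, Matrix.SpecialLinearGroup.coe_mul, Matrix.SpecialLinearGroup.coe_mul]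
      noncomm_ring
    rw [h1, sub_mul, ← Matrix.SpecialLinearGroup.coe_mul, ← Matrix.SpecialLinearGroup.coe_mul,
      mul_inv_cancel, _root_.mul_inv_rev, Matrix.SpecialLinearGroup.coe_one]
    simp only [mul_assoc]
  rw [SL2.dev_eq, hcomm]
  have e1 := entryNorm_mul_le (M * D + -(D * M)) ((h * g)⁻¹ : SL2)
  rw [SL2.entryNorm_inv] at e1
  have e2 := entryNorm_add_le (M * D) (-(D * M))
  rw [entryNorm_neg] at e2
  have e3 := entryNorm_mul_le M D
  have e4 := entryNorm_mul_le D M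
  have e5 := entryNorm_mul_le (h : Matrix (Fin 2) (Fin 2) ℝ) g
  rw [← Matrix.SpecialLinearGroup.coe_mul] at e5
  have e6 := SL2.entryNorm_le g
  have e7 := SL2.entryNorm_le h
  rw [hM, ← SL2.dev_eq, hD, ← SL2.dev_eq] at e3 e4
  have n1 := SL2.dev_nonneg g
  have n2 := SL2.dev_nonneg h
  have e8 : entryNorm ((h * g : SL2) : Matrix (Fin 2) (Fin 2) ℝ) ≤ 5 := by
    calc _ ≤ entryNorm (h : Matrix (Fin 2) (Fin 2) ℝ) *
          entryNorm (g : Matrix (Fin 2) (Fin 2) ℝ) := e5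
      _ ≤ (2 + 1/40) * (2 + 1/40) := by
        gcongr
        · exact entryNorm_nonneg _
        · linarith
        · linarith
      _ ≤ 5 := by norm_num
  have e9 : entryNorm (M * D + -(D * M)) ≤ SL2.dev g / 20 := by nlinarith
  calc _ ≤ _ := e1
    _ ≤ (SL2.dev g / 20) * 5 := by
      gcongr
      exact entryNorm_nonneg _
    _ ≤ SL2.dev g / 2 := by linarith

theorem SL2.mul_comm_iff (g h : SL2) : g * h = h * g ↔
    g 0 1 * h 1 0 = g 1 0 * h 0 1 ∧
    g 0 1 * (h 0 0 - h 1 1) = h 0 1 * (g 0 0 - g 1 1) ∧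
    g 1 0 * (h 0 0 - h 1 1) = h 1 0 * (g 0 0 - g 1 1) := by
  rw [Matrix.SpecialLinearGroup.ext_iff]
  simp only [Matrix.SpecialLinearGroup.coe_mul, Matrix.mul_apply, Fin.sum_univ_two,
    Fin.forall_fin_two]
  constructor
  · rintro ⟨⟨h1, h2⟩, h3, h4⟩
    refine ⟨by linarith, by linarith, by linarith⟩
  · rintro ⟨h1, h2, h3⟩
    refine ⟨⟨by linarith, by linarith⟩, by linarith, by linarith⟩

theorem SL2.not_scalar_of_dev_lt_one {g : SL2} (hg : SL2.dev g < 1) (h1 : g ≠ 1) :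
    g 0 1 ≠ 0 ∨ g 1 0 ≠ 0 ∨ g 0 0 - g 1 1 ≠ 0 := by
  by_contra! h
  obtain ⟨ha, hb, hc⟩ := h
  apply h1
  have hdet := g.2
  rw [Matrix.det_fin_two] at hdet
  have hle : |g 0 0 - 1| < 1 := by
    unfold SL2.dev at hg
    have h1 := abs_nonneg (g 0 1)
    have h2 := abs_nonneg (g 1 0)
    have h3 := abs_nonneg (g 1 1 - 1)
    linarith
  have hpos := abs_lt.1 hle
  have h00 : g 0 0 = 1 := by nlinarith
  ext i j
  fin_cases i <;> fin_cases j <;> simp <;> linarith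

theorem SL2.mul_comm_trans {g h k : SL2} (hgh : g * h = h * g) (hgk : g * k = k * g)
    (hg : g 0 1 ≠ 0 ∨ g 1 0 ≠ 0 ∨ g 0 0 - g 1 1 ≠ 0) : h * k = k * h := by
  rw [SL2.mul_comm_iff] at *
  obtain ⟨a1, a2, a3⟩ := hgh
  obtain ⟨b1, b2, b3⟩ := hgk
  rcases hg with hg | hg | hg <;> refine ⟨?_, ?_, ?_⟩ <;> apply mul_left_cancel₀ hg <;> grind

theorem commute_of_stabilizer_of_dev_le {Γ : Subgroup SL2} [DiscreteTopology Γ] {y : XQuot Γ}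
    {g h : SL2} (hg : rmul Γ y g = y) (hh : rmul Γ y h = y) (hg' : SL2.dev g ≤ 1 / 40)
    (hh' : SL2.dev h ≤ 1 / 40) : g * h = h * g := by
  by_cases hg1 : g = 1
  · simp [hg1]
  obtain ⟨δ, hδ, hδy⟩ := SL2.exists_dev_lt_of_mem_nhds
    ((eventually_eq_one_of_rmul_eq y).curry.self_of_nhds)
  set S : Set ℝ := SL2.dev '' {w | rmul Γ y w = y ∧ w ≠ 1} with hS
  have hne : S.Nonempty := ⟨_, g, ⟨hg, hg1⟩, rfl⟩
  have hbdd : BddBelow S := ⟨0, by rintro _ ⟨w, -, rfl⟩; exact SL2.dev_nonneg w⟩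
  have hlow : δ ≤ sInf S := le_csInf hne (by
    rintro _ ⟨w, ⟨hw, hw1⟩, rfl⟩
    by_contra! hlt
    exact hw1 (hδy w hlt hw))
  obtain ⟨m, hm, hm1, hmd, hmg⟩ : ∃ m, rmul Γ y m = y ∧ m ≠ 1 ∧ SL2.dev m < 2 * sInf S ∧
      SL2.dev m ≤ SL2.dev g := by
    by_cases hlt : SL2.dev g < 2 * sInf S
    · exact ⟨g, hg, hg1, hlt, le_rfl⟩
    · obtain ⟨_, ⟨m, ⟨hm, hm1⟩, rfl⟩, hlt'⟩ := exists_lt_of_csInf_lt hne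
        (show sInf S < 2 * sInf S by linarith)
      exact ⟨m, hm, hm1, hlt', by linarith⟩
  have stab_inv {w : SL2} (hw : rmul Γ y w = y) : rmul Γ y w⁻¹ = y := by
    nth_rw 1 [← hw]
    rw [rmul_rmul, mul_inv_cancel, rmul_one]
  have hcomm (w : SL2) (hw : rmul Γ y w = y) (hw' : SL2.dev w ≤ 1 / 40) : m * w = w * m := by
    have h1 := SL2.dev_commutator_le (hmg.trans hg') hw'
    have h2 : rmul Γ y (m * w * m⁻¹ * w⁻¹) = y := by
      simp only [← rmul_rmul, hm, hw, stab_inv]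
    have h3 : m * w * m⁻¹ * w⁻¹ = 1 := by
      by_contra hne1
      have := csInf_le hbdd ⟨_, ⟨h2, hne1⟩, rfl⟩
      linarith
    rw [mul_inv_eq_one, mul_inv_eq_iff_eq_mul] at h3
    exact h3
  exact SL2.mul_comm_trans (hcomm g hg hg') (hcomm h hh hh')
    (SL2.not_scalar_of_dev_lt_one (by linarith) hm1)

end Commutators

section Cusps

theorem eventually_exists_stabilizer_mem {Γ : Subgroup SL2} (hlat : IsLatticeSL2 Γ)
    {Ω : Set SL2} (hΩ : Ω ∈ 𝓝 1) :
    ∀ᶠ x in cocompact (XQuot Γ), ∃ w ∈ Ω, w ≠ 1 ∧ rmul Γ x w = x := by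
  obtain ⟨hdisc, ν, hν, F, hF, hFtop⟩ := hlat
  have : Countable Γ := countable_of_Lindelof_of_discrete
  obtain ⟨V₀, hV₀, hV₀Ω⟩ := exists_nhds_split_inv hΩ
  obtain ⟨V, hV, hVV₀, hVc⟩ := local_compact_nhds hV₀
  by_contra hcon
  rw [not_eventually] at hcon
  push Not at hcon
  obtain ⟨x, hxP, hxsep⟩ := exists_seq_of_forall_finset_exists
    (fun x : XQuot Γ => ∀ w ∈ Ω, w ≠ 1 → rmul Γ x w ≠ x)
    (fun x y => ∀ v ∈ V, ∀ v' ∈ V, rmul Γ y v' ≠ rmul Γ x v) (by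
      intro s _
      have hcpt : IsCompact (⋃ x ∈ s, (fun p : SL2 × SL2 => rmul Γ x (p.1 * p.2⁻¹)) ''
          (V ×ˢ V)) := by
        refine s.isCompact_biUnion fun x _ => (hVc.prod hVc).image ?_
        exact continuous_rmul.comp (continuous_const.prodMk (by fun_prop))
      obtain ⟨y, hyP, hy⟩ := (hcon.and_eventually hcpt.compl_mem_cocompact).exists
      refine ⟨y, hyP, fun x hx v hv v' hv' h => hy ?_⟩
      refine Set.mem_biUnion hx ⟨(v, v'), ⟨hv, hv'⟩, ?_⟩
      simp only [← rmul_rmul, ← h]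
      rw [rmul_rmul, mul_inv_cancel, rmul_one])
  have key {n m : ℕ} {v v' : SL2} (hv : v ∈ V) (hv' : v' ∈ V)
      (h : rmul Γ (x n) v = rmul Γ (x m) v') : n = m ∧ v = v' := by
    rcases lt_trichotomy n m with hnm | rfl | hnm
    · exact absurd h.symm (hxsep n m hnm v hv v' hv')
    · refine ⟨rfl, ?_⟩
      have h1 : rmul Γ (x n) (v / v') = x n := by
        rw [div_eq_mul_inv, ← rmul_rmul, h, rmul_rmul, mul_inv_cancel, rmul_one]
      by_contra hne
      exact hxP n _ (hV₀Ω v (hVV₀ hv) v' (hVV₀ hv')) (div_ne_one.2 hne) h1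
    · exact absurd h (hxsep m n hnm v' hv' v hv)
  choose g hg using fun n => qmk_surjective (x n)
  have hqv (n : ℕ) (z : SL2) : qmk Γ z = rmul Γ (x n) ((g n)⁻¹ * z) := by
    rw [← hg, rmul_qmk, mul_inv_cancel_left]
  set t : ℕ → Set SL2 := fun n => (fun h => (g n)⁻¹ * h) ⁻¹' V with ht
  have htm (n : ℕ) : MeasurableSet (t n) :=
    (hVc.isClosed.preimage (continuous_const_mul _)).measurableSet
  have hle : ν (⋃ n, t n) ≤ ν F := by
    refine hF.measure_le_of_pairwise_disjoint (MeasurableSet.iUnion htm).nullMeasurableSet ?_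
    intro γ γ' hne
    refine Disjoint.aedisjoint (Set.disjoint_left.2 ?_)
    rintro z ⟨hz, -⟩ ⟨hz', -⟩
    rw [Set.mem_smul_set_iff_inv_smul_mem, Set.mem_iUnion] at hz hz'
    obtain ⟨n, hn⟩ := hz
    obtain ⟨m, hm⟩ := hz'
    have e (γ : Γ) : qmk Γ (γ⁻¹ • z) = qmk Γ z := by
      rw [qmk_eq_iff, Subgroup.smul_def, smul_eq_mul]
      simp
    have := key hn hm (by rw [← hqv, ← hqv, e, e])
    obtain ⟨rfl, h⟩ := this
    have h2 := mul_right_cancel (mul_left_cancel h)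
    exact hne (inv_injective (Subtype.ext h2))
  have hsum : ν (⋃ n, t n) = ∑' _ : ℕ, ν V := by
    rw [measure_iUnion ?_ htm]
    · simp only [ht, measure_preimage_mul]
    · intro n m hnm
      refine Set.disjoint_left.2 fun z hz hz' => hnm ?_
      exact (key hz hz' (by rw [← hqv, ← hqv])).1
  rw [hsum, ENNReal.tsum_const_eq_top_of_ne_zero (Measure.measure_pos_of_mem_nhds ν hV).ne'] at hle
  exact hFtop (top_le_iff.1 hle)

/-- The unipotent matrix `[[1, x], [0, 1]]`. -/
def umat (x : ℝ) : SL2 := ⟨!![1, x; 0, 1], by simp⟩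

theorem SL2.mul_entry (g h : SL2) (i j : Fin 2) :
    (g * h) i j = g i 0 * h 0 j + g i 1 * h 1 j := by
  rw [Matrix.SpecialLinearGroup.coe_mul, Matrix.mul_apply, Fin.sum_univ_two]

theorem umat_entries (x : ℝ) :
    umat x 0 0 = 1 ∧ umat x 0 1 = x ∧ umat x 1 0 = 0 ∧ umat x 1 1 = 1 :=
  ⟨rfl, rfl, rfl, rfl⟩

theorem amat_entries (t : ℝ) : amat t 0 0 = Real.exp (t / 2) ∧ amat t 0 1 = 0 ∧
    amat t 1 0 = 0 ∧ amat t 1 1 = Real.exp (-(t / 2)) :=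
  ⟨rfl, rfl, rfl, rfl⟩

theorem umat_add (x y : ℝ) : umat (x + y) = umat x * umat y := by
  ext i j
  fin_cases i <;> fin_cases j <;> simp [SL2.mul_entry, umat_entries, add_comm]

theorem umat_zero : umat 0 = 1 := by
  ext i j
  fin_cases i <;> fin_cases j <;> simp [umat]

theorem umat_inv (x : ℝ) : (umat x)⁻¹ = umat (-x) := by
  rw [inv_eq_iff_mul_eq_one, ← umat_add, add_neg_cancel, umat_zero]

theorem amat_add (s t : ℝ) : amat (s + t) = amat s * amat t := by
  ext i j
  fin_cases i <;> fin_cases j <;>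
    simp [SL2.mul_entry, amat_entries, ← Real.exp_add] <;> ring

theorem amat_zero : amat 0 = 1 := by
  ext i j
  fin_cases i <;> fin_cases j <;> simp [amat]

theorem amat_inv (t : ℝ) : (amat t)⁻¹ = amat (-t) := by
  rw [inv_eq_iff_mul_eq_one, ← amat_add, add_neg_cancel, amat_zero]

theorem continuous_amat : Continuous amat := by
  rw [SL2.continuous_iff_entry]
  intro i j
  fin_cases i <;> fin_cases j <;> simp [amat] <;> fun_prop

theorem continuous_umat : Continuous umat := by
  rw [SL2.continuous_iff_entry]
  intro i j
  fin_cases i <;> fin_cases j <;> simp [umat] <;> fun_prop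

theorem amat_conj_entries (s : ℝ) (g : SL2) :
    (amat (-s) * g * amat s) 0 0 = g 0 0 ∧
    (amat (-s) * g * amat s) 0 1 = Real.exp (-s) * g 0 1 ∧
    (amat (-s) * g * amat s) 1 0 = Real.exp s * g 1 0 ∧
    (amat (-s) * g * amat s) 1 1 = g 1 1 := by
  have h1 : Real.exp (-s / 2) * Real.exp (s / 2) = 1 := by rw [← Real.exp_add]; ring_nf; simp
  have h2 : Real.exp (-s / 2) * Real.exp (-(s / 2)) = Real.exp (-s) := by
    rw [← Real.exp_add]; ring_nf
  have h3 : Real.exp (-(-s / 2)) * Real.exp (s / 2) = Real.exp s := by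
    rw [← Real.exp_add]; ring_nf
  have h4 : Real.exp (-(-s / 2)) * Real.exp (-(s / 2)) = 1 := by
    rw [← Real.exp_add]; ring_nf; simp
  simp only [SL2.mul_entry, amat_entries]
  refine ⟨?_, ?_, ?_, ?_⟩
  · linear_combination g 0 0 * h1
  · linear_combination g 0 1 * h2
  · linear_combination g 1 0 * h3
  · linear_combination g 1 1 * h4

theorem dev_amat_conj (s : ℝ) (g : SL2) : SL2.dev (amat (-s) * g * amat s) =
    |g 0 0 - 1| + Real.exp (-s) * |g 0 1| + Real.exp s * |g 1 0| + |g 1 1 - 1| := by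
  obtain ⟨h1, h2, h3, h4⟩ := amat_conj_entries s g
  simp only [SL2.dev, h1, h2, h3, h4, abs_mul, Real.abs_exp]

theorem dev_amat_conj_add_one_le (s : ℝ) (g : SL2) :
    SL2.dev (amat (-(s + 1)) * g * amat (s + 1)) ≤ 3 * SL2.dev (amat (-s) * g * amat s) := by
  rw [dev_amat_conj, dev_amat_conj]
  have h1 : Real.exp (-(s + 1)) ≤ Real.exp (-s) := Real.exp_le_exp.2 (by linarith)
  have h2 : Real.exp (s + 1) ≤ 3 * Real.exp s := by
    rw [Real.exp_add]
    nlinarith [Real.exp_one_lt_d9, Real.exp_pos s]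
  have h3 := mul_le_mul_of_nonneg_right h1 (abs_nonneg (g 0 1))
  have h4 := mul_le_mul_of_nonneg_right h2 (abs_nonneg (g 1 0))
  have h5 := abs_nonneg (g 0 0 - 1)
  have h6 := abs_nonneg (g 1 1 - 1)
  have h7 := mul_nonneg (Real.exp_pos (-s)).le (abs_nonneg (g 0 1))
  linarith

theorem rmul_eq_iff_conj {Γ : Subgroup SL2} {y : XQuot Γ} (a w : SL2) :
    rmul Γ (rmul Γ y a) (a⁻¹ * w * a) = rmul Γ y a ↔ rmul Γ y w = y := by
  rw [rmul_rmul, show a * (a⁻¹ * w * a) = w * a by group, ← rmul_rmul]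
  exact (rmul_injective_left a).eq_iff

/-- If a geodesic ray leaves every compact set, then its starting point is fixed by a unipotent
element which is contracted along the ray. -/
theorem exists_umat_stabilizer {Γ : Subgroup SL2} (hlat : IsLatticeSL2 Γ) {y : XQuot Γ}
    (hy : Tendsto (fun s => rmul Γ y (amat s)) atTop (cocompact (XQuot Γ))) :
    ∃ c > 0, rmul Γ y (umat c) = y := by
  have hdisc := hlat.1
  have hsmall (ε : ℝ) (hε : 0 < ε) : ∀ᶠ s in atTop, ∃ γ : SL2, γ ≠ 1 ∧ rmul Γ y γ = y ∧
      SL2.dev (amat (-s) * γ * amat s) < ε := by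
    filter_upwards [hy.eventually
      (eventually_exists_stabilizer_mem hlat (SL2.setOf_dev_lt_mem_nhds hε))] with s hs
    obtain ⟨w, hw, hw1, hws⟩ := hs
    refine ⟨amat s * w * (amat s)⁻¹, ?_, ?_, ?_⟩
    · rwa [Ne, conj_eq_one_iff]
    · rw [← rmul_eq_iff_conj (amat s)]
      simpa [mul_assoc] using hws
    · rw [← amat_inv]
      simpa [mul_assoc] using hw
  obtain ⟨S, hS⟩ := eventually_atTop.1 (hsmall (1 / 120) (by norm_num))
  obtain ⟨m, hm1, hmy, hmd⟩ := hS S le_rfl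
  have hcomm {s : ℝ} {g h : SL2} (hg : rmul Γ y g = y) (hh : rmul Γ y h = y)
      (hg' : SL2.dev (amat (-s) * g * amat s) ≤ 1 / 40)
      (hh' : SL2.dev (amat (-s) * h * amat s) ≤ 1 / 40) : g * h = h * g := by
    rw [← rmul_eq_iff_conj (amat s)] at hg hh
    rw [← amat_inv] at hg' hh'
    have := commute_of_stabilizer_of_dev_le hg hh hg' hh'
    have h2 := congrArg (fun z => amat s * z * (amat s)⁻¹) this
    simpa [mul_assoc] using h2
  have hns {s : ℝ} {g : SL2} (hg1 : g ≠ 1) (hg' : SL2.dev (amat (-s) * g * amat s) < 1) :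
      g 0 1 ≠ 0 ∨ g 1 0 ≠ 0 ∨ g 0 0 - g 1 1 ≠ 0 := by
    have h1 := SL2.not_scalar_of_dev_lt_one hg' (by
      rw [← amat_inv]
      intro h
      apply hg1
      have := congrArg (fun z => amat s * z * (amat s)⁻¹) h
      simpa [mul_assoc] using this)
    obtain ⟨e1, e2, e3, e4⟩ := amat_conj_entries s g
    rw [e1, e2, e3, e4] at h1
    simpa [Real.exp_ne_zero] using h1
  have hmns := hns hm1 (hmd.trans (by norm_num))
  have hchain (n : ℕ) : ∀ γ : SL2, rmul Γ y γ = y →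
      SL2.dev (amat (-(S + n)) * γ * amat (S + n)) ≤ 1 / 40 → m * γ = γ * m := by
    induction n with
    | zero =>
      intro γ hγ hγd
      rw [Nat.cast_zero, add_zero] at hγd
      exact hcomm hmy hγ (hmd.le.trans (by norm_num)) hγd
    | succ n ih =>
      intro γ hγ hγd
      obtain ⟨γ', hγ'1, hγ', hγ'd⟩ := hS (S + n) (by linarith [(n.cast_nonneg : (0 : ℝ) ≤ n)])
      have h1 := ih γ' hγ' (hγ'd.le.trans (by norm_num))
      have h2 := dev_amat_conj_add_one_le (S + n) γ'
      push_cast at hγd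
      rw [← add_assoc] at hγd
      have h3 := hcomm hγ' hγ (by linarith) hγd
      exact SL2.mul_comm_trans h1.symm h3 (hns hγ'1 (hγ'd.trans (by norm_num)))
  obtain ⟨δ, hδ, hδy⟩ := SL2.exists_dev_lt_of_mem_nhds
    ((eventually_eq_one_of_rmul_eq y).curry.self_of_nhds)
  have hfind (ε : ℝ) (hε : 0 < ε) : ∃ γ : SL2, δ ≤ SL2.dev γ ∧ m * γ = γ * m ∧
      |γ 0 0 - 1| < ε ∧ |γ 1 0| < ε ∧ |γ 1 1 - 1| < ε := by
    obtain ⟨S', hS'⟩ := eventually_atTop.1 (hsmall (min ε (1 / 40)) (by positivity))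
    obtain ⟨n, hn⟩ := exists_nat_ge (max (S' - S) (-S))
    obtain ⟨γ, hγ1, hγ, hγd⟩ := hS' (S + n) (by linarith [le_max_left (S' - S) (-S)])
    have hγε := hγd.trans_le (min_le_left _ _)
    refine ⟨γ, ?_, hchain n γ hγ (hγd.le.trans (min_le_right _ _)), ?_⟩
    · by_contra! hlt
      exact hγ1 (hδy γ hlt hγ)
    · rw [dev_amat_conj] at hγε
      have h0 : 1 ≤ Real.exp (S + n) := Real.one_le_exp (by linarith [le_max_right (S' - S) (-S)])
      have h1 := mul_le_mul_of_nonneg_right h0 (abs_nonneg (γ 1 0))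
      have h5 := abs_nonneg (γ 0 0 - 1)
      have h6 := abs_nonneg (γ 1 1 - 1)
      have h7 := mul_nonneg (Real.exp_pos (-(S + n))).le (abs_nonneg (γ 0 1))
      have h8 := abs_nonneg (γ 1 0)
      refine ⟨?_, ?_, ?_⟩ <;> linarith
  have hdev_small (C : ℝ) (hC : 0 ≤ C) (h : ∀ γ : SL2, m * γ = γ * m →
      |γ 0 1| ≤ C * (|γ 1 0| + |γ 0 0 - 1| + |γ 1 1 - 1|)) : False := by
    obtain ⟨γ, h1, h2, h3, h4, h5⟩ := hfind (δ / (3 * (C + 1))) (by positivity)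
    have h6 := h γ h2
    have h7 : |γ 1 0| + |γ 0 0 - 1| + |γ 1 1 - 1| < δ / (C + 1) := by
      have : δ / (3 * (C + 1)) * 3 = δ / (C + 1) := by field_simp
      linarith
    rw [lt_div_iff₀ (by positivity)] at h7
    unfold SL2.dev at h1
    nlinarith
  have hm10 : m 1 0 = 0 := by
    by_contra hne
    refine hdev_small (|m 0 1| / |m 1 0|) (by positivity) fun γ hγ => ?_
    have h1 := ((SL2.mul_comm_iff _ _).1 hγ).1
    have h2 : γ 0 1 = m 0 1 / m 1 0 * γ 1 0 := by
      field_simp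
      linarith
    rw [h2, abs_mul, abs_div]
    gcongr
    linarith [abs_nonneg (γ 0 0 - 1), abs_nonneg (γ 1 1 - 1)]
  have hmd0 : m 0 0 - m 1 1 = 0 := by
    by_contra hne
    refine hdev_small (|m 0 1| / |m 0 0 - m 1 1|) (by positivity) fun γ hγ => ?_
    have h1 := ((SL2.mul_comm_iff _ _).1 hγ).2.1
    have h2 : γ 0 1 = m 0 1 / (m 0 0 - m 1 1) * ((γ 0 0 - 1) - (γ 1 1 - 1)) := by
      field_simp
      linarith
    rw [h2, abs_mul, abs_div]
    gcongr
    linarith [abs_nonneg (γ 1 0), abs_sub (γ 0 0 - 1) (γ 1 1 - 1)]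
  have hdet := m.2
  rw [Matrix.det_fin_two] at hdet
  rw [dev_amat_conj] at hmd
  have hm00 : m 0 0 = 1 := by
    have hpos : |m 0 0 - 1| < 1 := by
      have h6 := abs_nonneg (m 1 1 - 1)
      have h7 := mul_nonneg (Real.exp_pos (-S)).le (abs_nonneg (m 0 1))
      have h8 := mul_nonneg (Real.exp_pos S).le (abs_nonneg (m 1 0))
      linarith
    have := abs_lt.1 hpos
    have h9 : m 0 0 * m 0 0 = 1 := by
      rw [hm10] at hdet
      linear_combination hdet + m 0 0 * hmd0
    nlinarith
  have hmu : m = umat (m 0 1) := by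
    ext i j
    fin_cases i <;> fin_cases j <;> simp [umat] <;> linarith
  have hm01 : m 0 1 ≠ 0 := fun h => hm1 (by rw [hmu, h, umat_zero])
  rcases hm01.lt_or_gt with hlt | hgt
  · refine ⟨-m 0 1, by linarith, ?_⟩
    rw [← umat_inv, ← hmu]
    nth_rw 1 [← hmy]
    rw [rmul_rmul, mul_inv_cancel, rmul_one]
  · exact ⟨m 0 1, hgt, by rwa [← hmu]⟩

end Cusps

section Mautner

open scoped InnerProductSpace

/-- The unipotent matrix `[[1, 0], [y, 1]]`. -/
def vmat (y : ℝ) : SL2 := ⟨!![1, 0; y, 1], by simp⟩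

theorem vmat_entries (y : ℝ) :
    vmat y 0 0 = 1 ∧ vmat y 0 1 = 0 ∧ vmat y 1 0 = y ∧ vmat y 1 1 = 1 :=
  ⟨rfl, rfl, rfl, rfl⟩

theorem vmat_zero : vmat 0 = 1 := by
  ext i j
  fin_cases i <;> fin_cases j <;> simp [vmat]

theorem continuous_vmat : Continuous vmat := by
  rw [SL2.continuous_iff_entry]
  intro i j
  fin_cases i <;> fin_cases j <;> simp [vmat] <;> fun_prop

theorem amat_conj_umat (s x : ℝ) :
    amat (-s) * umat x * amat s = umat (Real.exp (-s) * x) := by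
  obtain ⟨h1, h2, h3, h4⟩ := amat_conj_entries s (umat x)
  ext i j
  fin_cases i <;> fin_cases j <;> simp [h1, h2, h3, h4, umat_entries]

theorem amat_conj_vmat (s y : ℝ) :
    amat (-s) * vmat y * amat s = vmat (Real.exp s * y) := by
  obtain ⟨h1, h2, h3, h4⟩ := amat_conj_entries s (vmat y)
  ext i j
  fin_cases i <;> fin_cases j <;> simp [h1, h2, h3, h4, vmat_entries]

theorem SL2.eq_vmat_mul_umat_mul_vmat {g : SL2} (hg : g 0 1 ≠ 0) :
    g = vmat ((g 1 1 - 1) / g 0 1) * umat (g 0 1) * vmat ((g 0 0 - 1) / g 0 1) := by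
  have hdet := g.2
  rw [Matrix.det_fin_two] at hdet
  ext i j
  fin_cases i <;> fin_cases j <;> simp [SL2.mul_entry, umat_entries, vmat_entries] <;> field_simp
  · ring
  · linear_combination -hdet
  · ring

variable {H : Type*} [NormedAddCommGroup H] [InnerProductSpace ℝ H]

theorem eq_of_inner_eq_of_norm_eq {v w : H} (h1 : ⟪w, v⟫_ℝ = ⟪v, v⟫_ℝ) (h2 : ‖w‖ = ‖v‖) :
    w = v := by
  rw [← sub_eq_zero, ← norm_eq_zero, ← sq_eq_zero_iff, norm_sub_sq_real, h1, h2,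
    real_inner_self_eq_norm_sq]
  ring

theorem inner_apply_mul_mul_of_fixed (T : SL2 →* (H →ₗᵢ[ℝ] H)) {v : H} {g h k : SL2}
    (hg : T g v = v) (hk : T k v = v) : ⟪T (g * h * k) v, v⟫_ℝ = ⟪T h v, v⟫_ℝ := by
  rw [map_mul, map_mul, LinearIsometry.coe_mul, LinearIsometry.coe_mul, Function.comp_apply,
    Function.comp_apply, hk]
  nth_rw 2 [← hg]
  rw [LinearIsometry.inner_map_map]

/-- **Mautner phenomenon**: a vector fixed by the lower unipotent subgroup is fixed by
`SL(2, ℝ)`. -/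
theorem fixed_of_vmat_fixed (T : SL2 →* (H →ₗᵢ[ℝ] H)) {v : H}
    (hT : Continuous fun g => T g v) (hv : ∀ y, T (vmat y) v = v) (g : SL2) : T g v = v := by
  have hφ : Continuous fun g => ⟪T g v, v⟫_ℝ := hT.inner continuous_const
  have hb {g : SL2} (hg : g 0 1 ≠ 0) : ⟪T g v, v⟫_ℝ = ⟪T (umat (g 0 1)) v, v⟫_ℝ := by
    nth_rw 1 [SL2.eq_vmat_mul_umat_mul_vmat hg]
    exact inner_apply_mul_mul_of_fixed T (hv _) (hv _)
  have hA (t : ℝ) : T (amat t) v = v := by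
    refine eq_of_inner_eq_of_norm_eq ?_ (LinearIsometry.norm_map _ _)
    have h1 : Tendsto (fun x => ⟪T (amat t * umat x) v, v⟫_ℝ) (𝓝[≠] 0) (𝓝 ⟪T (amat t) v, v⟫_ℝ) := by
      have : Continuous fun x => ⟪T (amat t * umat x) v, v⟫_ℝ :=
        hφ.comp (continuous_const.mul continuous_umat)
      have h := (this.tendsto 0).mono_left (nhdsWithin_le_nhds (s := {0}ᶜ))
      rwa [umat_zero, mul_one] at h
    have h2 : Tendsto (fun x => ⟪T (umat (Real.exp (t / 2) * x)) v, v⟫_ℝ) (𝓝[≠] 0)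
        (𝓝 ⟪v, v⟫_ℝ) := by
      have : Continuous fun x => ⟪T (umat (Real.exp (t / 2) * x)) v, v⟫_ℝ :=
        hφ.comp (continuous_umat.comp (continuous_const.mul continuous_id))
      have h := (this.tendsto 0).mono_left (nhdsWithin_le_nhds (s := {0}ᶜ))
      rwa [mul_zero, umat_zero, map_one, LinearIsometry.coe_one, id] at h
    refine tendsto_nhds_unique h1 (h2.congr' ?_)
    filter_upwards [self_mem_nhdsWithin] with x hx
    have e : (amat t * umat x) 0 1 = Real.exp (t / 2) * x := by
      simp [SL2.mul_entry, amat_entries, umat_entries]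
    have h3 := hb (g := amat t * umat x) (by
      rw [e]; exact mul_ne_zero (Real.exp_ne_zero _) hx)
    rw [e] at h3
    exact h3.symm
  have hU (x : ℝ) : T (umat x) v = v := by
    refine eq_of_inner_eq_of_norm_eq ?_ (LinearIsometry.norm_map _ _)
    have h1 : Tendsto (fun s => ⟪T (umat (Real.exp (-s) * x)) v, v⟫_ℝ) atTop (𝓝 ⟪v, v⟫_ℝ) := by
      have h := (hφ.comp continuous_umat).tendsto 0
      rw [Function.comp_apply, umat_zero, map_one, LinearIsometry.coe_one, id] at h
      refine h.comp ?_
      simpa using (Real.tendsto_exp_neg_atTop_nhds_zero).mul_const x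
    refine tendsto_nhds_unique (tendsto_const_nhds (f := (atTop : Filter ℝ))) (h1.congr fun s => ?_)
    rw [← amat_conj_umat, inner_apply_mul_mul_of_fixed T (hA _) (hA _)]
  have hgen {g : SL2} (hg : g 0 1 ≠ 0) : T g v = v := by
    rw [SL2.eq_vmat_mul_umat_mul_vmat hg]
    simp only [map_mul, LinearIsometry.coe_mul, Function.comp_apply, hv, hU]
  by_cases hg : g 0 1 = 0
  · have h1 : (g * umat 1) 0 1 ≠ 0 := by
      have hdet := g.2
      rw [Matrix.det_fin_two] at hdet
      simp only [SL2.mul_entry, umat_entries, hg]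
      intro h
      simp only [mul_one, add_zero] at h
      simp [h, hg] at hdet
    have h2 : g = (g * umat 1) * umat (-1) := by
      rw [mul_assoc, ← umat_add, add_neg_cancel, umat_zero, mul_one]
    rw [h2, map_mul, LinearIsometry.coe_mul, Function.comp_apply, hU, hgen h1]
  · exact hgen hg

/-- Weak limits along the geodesic flow in an isometric representation of `SL(2, ℝ)` are fixed
vectors. -/
theorem exists_fixed_weak_limit [CompleteSpace H] (T : SL2 →* (H →ₗᵢ[ℝ] H))
    (hT : ∀ v, Continuous fun g => T g v) (f : H) (𝒰 : Ultrafilter ℝ)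
    (h𝒰 : (𝒰 : Filter ℝ) ≤ atTop) :
    ∃ v : H, (∀ g, T g v = v) ∧
      ∀ k, Tendsto (fun t => ⟪T (amat (-t)) f, k⟫_ℝ) 𝒰 (𝓝 ⟪v, k⟫_ℝ) := by
  obtain ⟨L, -, hL⟩ :=
    (WeakDual.isCompact_closedBall (𝕜 := ℝ) (0 : StrongDual ℝ H) ‖f‖).ultrafilter_le_nhds
    (𝒰.map fun t => StrongDual.toWeakDual (InnerProductSpace.toDual ℝ H (T (amat (-t)) f))) (by
      rw [le_principal_iff, Ultrafilter.mem_coe, Ultrafilter.mem_map]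
      refine Filter.mem_of_superset Filter.univ_mem fun t _ => ?_
      simp only [Set.mem_preimage, mem_closedBall_zero_iff]
      refine (LinearIsometryEquiv.norm_map (InnerProductSpace.toDual ℝ H) _).trans_le ?_
      rw [LinearIsometry.norm_map])
  obtain ⟨v, hv⟩ := (InnerProductSpace.toDual ℝ H).surjective (WeakDual.toStrongDual L)
  have hlim (k : H) : Tendsto (fun t => ⟪T (amat (-t)) f, k⟫_ℝ) 𝒰 (𝓝 ⟪v, k⟫_ℝ) := by
    have h1 := ((WeakDual.eval_continuous (𝕜 := ℝ) k).tendsto L).comp hL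
    have h2 : L k = ⟪v, k⟫_ℝ := by
      rw [← InnerProductSpace.toDual_apply_apply (𝕜 := ℝ), hv]
      rfl
    rw [← h2]
    exact h1
  refine ⟨v, fixed_of_vmat_fixed T (hT v) fun y => ?_, hlim⟩
  refine ext_inner_right ℝ fun k => ?_
  have hinv (w : H) : ⟪T (vmat y) w, k⟫_ℝ = ⟪w, T (vmat y)⁻¹ k⟫_ℝ := by
    rw [← LinearIsometry.inner_map_map (T (vmat y)) w, ← Function.comp_apply (f := T (vmat y)),
      ← LinearIsometry.coe_mul, ← map_mul, mul_inv_cancel, map_one, LinearIsometry.coe_one, id]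
  have h1 : Tendsto (fun t => ⟪T (vmat y) (T (amat (-t)) f), k⟫_ℝ) 𝒰 (𝓝 ⟪T (vmat y) v, k⟫_ℝ) := by
    simp only [hinv]
    exact hlim _
  refine tendsto_nhds_unique h1 ?_
  have h2 : Tendsto (fun t => T (vmat (Real.exp (-t) * y)) f) 𝒰 (𝓝 f) := by
    have h := ((hT f).comp continuous_vmat).tendsto 0
    rw [Function.comp_apply, vmat_zero, map_one, LinearIsometry.coe_one, id] at h
    refine h.comp (Tendsto.mono_left ?_ h𝒰)
    simpa using (Real.tendsto_exp_neg_atTop_nhds_zero).mul_const y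
  have h3 : Tendsto (fun t => ⟪T (vmat y) (T (amat (-t)) f), k⟫_ℝ - ⟪T (amat (-t)) f, k⟫_ℝ) 𝒰
      (𝓝 0) := by
    have h4 : Tendsto (fun t => ‖T (vmat (Real.exp (-t) * y)) f - f‖ * ‖k‖) 𝒰 (𝓝 0) := by
      simpa using (tendsto_iff_norm_sub_tendsto_zero.1 h2).mul_const ‖k‖
    refine squeeze_zero_norm (fun t => ?_) h4
    rw [← inner_sub_left]
    refine (norm_inner_le_norm _ _).trans (mul_le_mul_of_nonneg_right ?_ (norm_nonneg _))
    have e : T (vmat y) (T (amat (-t)) f) = T (amat (-t)) (T (vmat (Real.exp (-t) * y)) f) := by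
      have hm (g h : SL2) : T g (T h f) = T (g * h) f := by
        rw [map_mul, LinearIsometry.coe_mul, Function.comp_apply]
      rw [hm, hm, ← amat_conj_vmat, neg_neg, ← mul_assoc, ← mul_assoc, ← amat_add, neg_add_cancel,
        amat_zero, one_mul]
    rw [e, ← map_sub, LinearIsometry.norm_map]
  simpa using h3.add (hlim k)

end Mautner

section Mixing

variable {Γ : Subgroup SL2}

instance : MulAction SL2 (XQuot Γ) where
  smul g x := rmul Γ x g⁻¹
  one_smul x := by
    change rmul Γ x 1⁻¹ = x
    rw [inv_one, rmul_one]
  mul_smul g h x := by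
    change rmul Γ x (g * h)⁻¹ = rmul Γ (rmul Γ x h⁻¹) g⁻¹
    rw [rmul_rmul, _root_.mul_inv_rev]

theorem smul_eq_rmul (g : SL2) (x : XQuot Γ) : g • x = rmul Γ x g⁻¹ := rfl

instance : ContinuousSMul SL2 (XQuot Γ) where
  continuous_smul := continuous_rmul.comp (continuous_snd.prodMk continuous_fst.inv)

theorem continuous_rmul_left (g : SL2) : Continuous fun x => rmul Γ x g :=
  continuous_rmul.comp (continuous_id.prodMk continuous_const)

theorem continuous_rmul_right (x : XQuot Γ) : Continuous fun g => rmul Γ x g :=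
  continuous_rmul.comp (continuous_const.prodMk continuous_id)

theorem measurableEmbedding_rmul (g : SL2) :
    MeasurableEmbedding fun x : XQuot Γ => rmul Γ x g := by
  simpa [smul_eq_rmul] using measurableEmbedding_const_smul (α := XQuot Γ) g⁻¹

theorem smulInvariantMeasure_xQuot {μ : Measure (XQuot Γ)}
    (hinv : ∀ g : SL2, Measure.map (fun x => rmul Γ x g) μ = μ) :
    SMulInvariantMeasure SL2 (XQuot Γ) μ where
  measure_preimage_smul g s hs := by
    conv_rhs => rw [← hinv g⁻¹]
    rw [Measure.map_apply (continuous_rmul_left _).measurable hs]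
    rfl

variable {μ : Measure (XQuot Γ)} [SMulInvariantMeasure SL2 (XQuot Γ) μ]

theorem measurePreserving_rmul (g : SL2) : MeasurePreserving (fun x => rmul Γ x g) μ μ := by
  simpa [smul_eq_rmul] using measurePreserving_smul g⁻¹ μ

variable (μ) in
/-- The unitary representation of `SL(2, ℝ)` on `L²(Γ\G)` by right translations. -/
def rightRep : SL2 →* (Lp ℝ 2 μ →ₗᵢ[ℝ] Lp ℝ 2 μ) where
  toFun g :=
    { toFun := fun f => DomMulAct.mk g⁻¹ • f
      map_add' := fun f k => smul_add _ f k
      map_smul' := fun c f => smul_comm _ c f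
      norm_map' := fun f => DomMulAct.norm_smul_Lp _ f }
  map_one' := by
    ext1 f
    change DomMulAct.mk (1 : SL2)⁻¹ • f = f
    rw [inv_one, DomMulAct.mk_one, one_smul]
  map_mul' g h := by
    ext1 f
    change DomMulAct.mk (g * h)⁻¹ • f = DomMulAct.mk g⁻¹ • DomMulAct.mk h⁻¹ • f
    rw [_root_.mul_inv_rev, DomMulAct.mk_mul, mul_smul]

theorem rightRep_ae_eq (g : SL2) (f : Lp ℝ 2 μ) :
    rightRep μ g f =ᵐ[μ] fun x => f (rmul Γ x g) := by
  refine (DomMulAct.smul_Lp_ae_eq (DomMulAct.mk g⁻¹) f).trans (Eventually.of_forall fun x => ?_)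
  simp [smul_eq_rmul]

variable [IsProbabilityMeasure μ]

theorem haar_setOf_rmul_mem_eq (B : Set (XQuot Γ)) (x y : XQuot Γ) :
    Measure.haar {g : SL2 | rmul Γ x g ∈ B} = Measure.haar {g : SL2 | rmul Γ y g ∈ B} := by
  obtain ⟨h, rfl⟩ := exists_rmul_eq x y
  rw [← measure_preimage_mul Measure.haar h {g : SL2 | rmul Γ x g ∈ B}]
  simp [Set.preimage, rmul_rmul]

theorem lintegral_haar_setOf_rmul_mem {B : Set (XQuot Γ)} (hB : MeasurableSet B) (x : XQuot Γ) :
    Measure.haar {g : SL2 | rmul Γ x g ∈ B} = μ B * Measure.haar (Set.univ : Set SL2) := by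
  have hS : MeasurableSet {p : XQuot Γ × SL2 | rmul Γ p.1 p.2 ∈ B} :=
    continuous_rmul.measurable hB
  have h1 := Measure.prod_apply (μ := μ) (ν := Measure.haar) hS
  have h2 := Measure.prod_apply_symm (μ := μ) (ν := Measure.haar) hS
  rw [h1] at h2
  have e1 (y : XQuot Γ) : Measure.haar (Prod.mk y ⁻¹' {p : XQuot Γ × SL2 | rmul Γ p.1 p.2 ∈ B})
      = Measure.haar {g : SL2 | rmul Γ x g ∈ B} := haar_setOf_rmul_mem_eq B y x
  have e2 (g : SL2) : μ ((fun y => (y, g)) ⁻¹' {p : XQuot Γ × SL2 | rmul Γ p.1 p.2 ∈ B}) = μ B :=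
    (measurePreserving_rmul g).measure_preimage hB.nullMeasurableSet
  simpa only [e1, e2, lintegral_const, measure_univ, mul_one] using h2

theorem measure_eq_zero_iff_haar {B : Set (XQuot Γ)} (hB : MeasurableSet B) (x : XQuot Γ) :
    μ B = 0 ↔ Measure.haar {g : SL2 | rmul Γ x g ∈ B} = 0 := by
  rw [lintegral_haar_setOf_rmul_mem (μ := μ) hB x, mul_eq_zero, or_iff_left]
  exact (Measure.measure_univ_ne_zero).2 (NeZero.ne _)

theorem ae_eq_const_of_forall_rmul {v : XQuot Γ → ℝ} (hv : Measurable v)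
    (h : ∀ g, ∀ᵐ x ∂μ, v (rmul Γ x g) = v x) : ∃ c, ∀ᵐ x ∂μ, v x = c := by
  have hS : MeasurableSet {p : XQuot Γ × SL2 | v (rmul Γ p.1 p.2) = v p.1} :=
    measurableSet_eq_fun (hv.comp continuous_rmul.measurable) (hv.comp measurable_fst)
  have h1 : ∀ᵐ x ∂μ, ∀ᵐ g ∂(Measure.haar : Measure SL2), v (rmul Γ x g) = v x := by
    rw [Measure.ae_ae_comm hS]
    exact Eventually.of_forall h
  obtain ⟨x, hx⟩ := h1.exists
  refine ⟨v x, ?_⟩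
  have hB : MeasurableSet {y | ¬ v y = v x} := (hv (measurableSet_singleton (v x))).compl
  exact (measure_eq_zero_iff_haar hB x).2 hx

variable [T2Space (XQuot Γ)]

theorem continuous_rightRep (f : Lp ℝ 2 μ) : Continuous fun g => rightRep μ g f := by
  have : Fact ((2 : ENNReal) ≠ ⊤) := ⟨by simp⟩
  have h : Continuous fun g : SL2 => (DomMulAct.mk g⁻¹ : SL2ᵈᵐᵃ) :=
    DomMulAct.continuous_mk.comp continuous_inv
  exact h.smul continuous_const

open scoped InnerProductSpace in
theorem tendsto_inner_rightRep (f k : Lp ℝ 2 μ) :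
    Tendsto (fun t => ⟪rightRep μ (amat (-t)) f, k⟫_ℝ) atTop
      (𝓝 ((∫ x, f x ∂μ) * ∫ x, k x ∂μ)) := by
  rw [tendsto_iff_ultrafilter]
  intro 𝒰 h𝒰
  obtain ⟨v, hv, hlim⟩ := exists_fixed_weak_limit (rightRep μ) continuous_rightRep f 𝒰 h𝒰
  obtain ⟨c, hc⟩ := ae_eq_const_of_forall_rmul (μ := μ) (Lp.stronglyMeasurable v).measurable
    fun g => by
      have := rightRep_ae_eq g v
      rw [hv] at this
      exact this.symm
  have hin (k : Lp ℝ 2 μ) : ⟪v, k⟫_ℝ = c * ∫ x, k x ∂μ := by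
    rw [L2.inner_def, ← integral_const_mul]
    refine integral_congr_ae ?_
    filter_upwards [hc] with x hx
    simp [hx, mul_comm]
  have hone (w : Lp ℝ 2 μ) : ⟪w, Lp.const 2 μ 1⟫_ℝ = ∫ x, w x ∂μ := by
    rw [L2.inner_def]
    refine integral_congr_ae ?_
    filter_upwards [Lp.coeFn_const (p := 2) (μ := μ) (1 : ℝ)] with x hx
    simp
  have h1 := hlim (Lp.const 2 μ 1)
  have h2 : (fun t => ⟪rightRep μ (amat (-t)) f, Lp.const 2 μ 1⟫_ℝ) = fun _ => ∫ x, f x ∂μ := by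
    ext t
    rw [hone, integral_congr_ae (rightRep_ae_eq _ f)]
    exact (measurePreserving_rmul (amat (-t))).integral_comp (measurableEmbedding_rmul _) _
  rw [h2, hin, integral_congr_ae (Lp.coeFn_const (p := 2) (μ := μ) (1 : ℝ))] at h1
  have h3 : ∫ x, f x ∂μ = c := by simpa using tendsto_nhds_unique tendsto_const_nhds h1
  rw [h3, ← hin]
  exact hlim k

open scoped InnerProductSpace in
theorem tendsto_integral_rmul_amat_mul {f k : XQuot Γ → ℝ} (hf : MemLp f 2 μ) (hk : MemLp k 2 μ) :
    Tendsto (fun t => ∫ x, k x * f (rmul Γ x (amat (-t))) ∂μ) atTop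
      (𝓝 ((∫ x, k x ∂μ) * ∫ x, f x ∂μ)) := by
  have h := tendsto_inner_rightRep (hf.toLp f) (hk.toLp k)
  rw [integral_congr_ae hf.coeFn_toLp, integral_congr_ae hk.coeFn_toLp, mul_comm] at h
  refine h.congr fun t => ?_
  rw [L2.inner_def]
  refine integral_congr_ae ?_
  filter_upwards [rightRep_ae_eq (amat (-t)) (hf.toLp f), hk.coeFn_toLp,
    (measurePreserving_rmul (amat (-t))).quasiMeasurePreserving.ae hf.coeFn_toLp] with x h1 h2 h3
  simp [h1, h2, h3]

/-- Mixing, for a test function against an absolutely continuous finite measure. -/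
theorem tendsto_integral_rmul_amat {η : Measure (XQuot Γ)} [IsFiniteMeasure η] (hη : η ≪ μ)
    (ψ : BoundedContinuousFunction (XQuot Γ) ℝ) :
    Tendsto (fun t => ∫ x, ψ (rmul Γ x (amat (-t))) ∂η) atTop
      (𝓝 (η.real Set.univ * ∫ x, ψ x ∂μ)) := by
  set F : XQuot Γ → ℝ := fun x => (η.rnDeriv μ x).toReal with hF
  have hFi : Integrable F μ := Measure.integrable_toReal_rnDeriv
  have hmass : ∫ x, F x ∂μ = η.real Set.univ := Measure.integral_toReal_rnDeriv hη
  have hdens (t : ℝ) : ∫ x, ψ (rmul Γ x (amat (-t))) ∂η = ∫ x, F x * ψ (rmul Γ x (amat (-t))) ∂μ :=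
    (integral_rnDeriv_smul hη).symm
  have hL2 (φ : BoundedContinuousFunction (XQuot Γ) ℝ) : MemLp φ 2 μ :=
    MemLp.of_bound φ.continuous.aestronglyMeasurable ‖φ‖ (Eventually.of_forall φ.norm_coe_le_norm)
  have hψi (t : ℝ) : AEStronglyMeasurable (fun x => ψ (rmul Γ x (amat (-t)))) μ :=
    (ψ.continuous.comp (continuous_rmul_left _)).aestronglyMeasurable
  have hint₀ {k : XQuot Γ → ℝ} (hk : Integrable k μ) (t : ℝ) :
      Integrable (fun x => k x * ψ (rmul Γ x (amat (-t)))) μ :=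
    hk.mul_bdd (c := ‖ψ‖) (hψi t) (Eventually.of_forall fun x => ψ.norm_coe_le_norm _)
  simp only [hdens, ← hmass]
  rw [Metric.tendsto_atTop]
  intro ε hε
  have hM : 0 ≤ ‖ψ‖ := norm_nonneg ψ
  obtain ⟨φ, hφ, hφi⟩ := hFi.exists_boundedContinuous_integral_sub_le
    (show 0 < ε / (4 * (‖ψ‖ + 1)) by positivity)
  have hδ : ε / (4 * (‖ψ‖ + 1)) * ‖ψ‖ ≤ ε / 4 := by
    rw [div_mul_eq_mul_div, div_le_div_iff₀ (by positivity) (by positivity)]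
    nlinarith
  have hclose {χ : XQuot Γ → ℝ} (hχ : ∀ x, ‖χ x‖ ≤ ‖ψ‖) :
      ∫ x, ‖(F x - φ x) * χ x‖ ∂μ ≤ ε / 4 := by
    refine le_trans ?_ (le_trans (mul_le_mul_of_nonneg_right hφ hM) hδ)
    rw [← integral_mul_const]
    refine integral_mono_of_nonneg (Eventually.of_forall fun x => norm_nonneg _)
      ((hFi.sub hφi).norm.mul_const _) (Eventually.of_forall fun x => ?_)
    simp only [norm_mul]
    exact mul_le_mul_of_nonneg_left (hχ x) (norm_nonneg _)
  obtain ⟨t₀, ht₀⟩ := Metric.tendsto_atTop.1 (tendsto_integral_rmul_amat_mul (hL2 ψ) (hL2 φ))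
    (ε / 4) (by positivity)
  refine ⟨t₀, fun t ht => ?_⟩
  have h1 := ht₀ t ht
  have h2 : |(∫ x, F x * ψ (rmul Γ x (amat (-t))) ∂μ) - ∫ x, φ x * ψ (rmul Γ x (amat (-t))) ∂μ|
      ≤ ε / 4 := by
    rw [← integral_sub (hint₀ hFi t) (hint₀ hφi t)]
    simp only [← sub_mul]
    exact (norm_integral_le_integral_norm _).trans (hclose fun x => ψ.norm_coe_le_norm _)
  have h3 : |(∫ x, F x ∂μ) * ∫ x, ψ x ∂μ - (∫ x, φ x ∂μ) * ∫ x, ψ x ∂μ| ≤ ε / 4 := by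
    have e : |∫ x, ψ x ∂μ| ≤ ‖ψ‖ := by
      simpa using norm_integral_le_of_norm_le_const (μ := μ)
        (Eventually.of_forall ψ.norm_coe_le_norm)
    rw [← sub_mul, ← integral_sub hFi hφi, ← integral_mul_const]
    exact (norm_integral_le_integral_norm _).trans (hclose fun x => e)
  rw [Real.dist_eq] at h1 ⊢
  rw [abs_lt] at h1 ⊢
  rw [abs_le] at h2 h3
  constructor <;> linarith [h1.1, h1.2, h2.1, h2.2, h3.1, h3.2]

end Mixing

section Horocycle

variable {Γ : Subgroup SL2} {ψ : XQuot Γ → ℝ}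

theorem eventually_forall_abs_rmul_sub_lt [T2Space (XQuot Γ)] (hcont : Continuous ψ)
    (hsupp : HasCompactSupport ψ) {ε : ℝ} (hε : 0 < ε) :
    ∀ᶠ w in 𝓝 (1 : SL2), ∀ x, |ψ (rmul Γ x w) - ψ x| < ε := by
  obtain ⟨V, hV, -, hVc⟩ := local_compact_nhds (univ_mem : Set.univ ∈ 𝓝 (1 : SL2))
  have hK : IsCompact ((fun p : XQuot Γ × SL2 => rmul Γ p.1 p.2) '' (tsupport ψ ×ˢ V⁻¹)) :=
    (IsCompact.prod hsupp hVc.inv).image continuous_rmul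
  have h1 := hK.eventually_forall_of_forall_eventually (x₀ := (1 : SL2))
    (P := fun w x => |ψ (rmul Γ x w) - ψ x| < ε) fun x _ => by
      have hc : Continuous fun z : SL2 × XQuot Γ => |ψ (rmul Γ z.2 z.1) - ψ z.2| :=
        ((hcont.comp (continuous_rmul.comp (continuous_snd.prodMk continuous_fst))).sub
          (hcont.comp continuous_snd)).abs
      exact hc.continuousAt.eventually_lt continuousAt_const (by simpa [rmul_one] using hε)
  filter_upwards [h1, hV] with w hw hwV x
  by_cases hx : x ∈ (fun p : XQuot Γ × SL2 => rmul Γ p.1 p.2) '' (tsupport ψ ×ˢ V⁻¹)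
  · exact hw x hx
  · have e1 : ψ x = 0 := by
      by_contra h
      exact hx ⟨(x, 1), ⟨subset_tsupport ψ h, by simpa using mem_of_mem_nhds hV⟩, rmul_one x⟩
    have e2 : ψ (rmul Γ x w) = 0 := by
      by_contra h
      refine hx ⟨(rmul Γ x w, w⁻¹), ⟨subset_tsupport ψ h, by simpa using hwV⟩, ?_⟩
      simp [rmul_rmul, rmul_one]
    simpa [e1, e2] using hε

theorem rmul_umat_mul_periodic {y : XQuot Γ} {c : ℝ} (hy : rmul Γ y (umat c) = y) (g : SL2) :
    Function.Periodic (fun x => rmul Γ y (umat x * g)) c := fun x => by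
  dsimp only
  rw [add_comm, umat_add, mul_assoc, ← rmul_rmul, hy]

theorem continuous_rmul_umat_mul (y : XQuot Γ) (g : SL2) :
    Continuous fun x => rmul Γ y (umat x * g) :=
  (continuous_rmul_right y).comp (continuous_umat.mul continuous_const)

theorem integral_umat_mul_eq {y : XQuot Γ} {c : ℝ} (hy : rmul Γ y (umat c) = y) (b : ℝ) (g : SL2) :
    ∫ x in (0)..c, ψ (rmul Γ y (umat x * (umat b * g))) =
      ∫ x in (0)..c, ψ (rmul Γ y (umat x * g)) := by
  have h1 := ((rmul_umat_mul_periodic hy g).comp ψ).intervalIntegral_add_eq b 0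
  have h2 := intervalIntegral.integral_comp_add_right (a := 0) (b := c)
    (fun x => ψ (rmul Γ y (umat x * g))) b
  simp only [umat_add, mul_assoc] at h2
  rw [h2]
  simpa [add_comm] using h1

theorem eventually_abs_integral_horocycle_sub_le [T2Space (XQuot Γ)] (hcont : Continuous ψ)
    (hsupp : HasCompactSupport ψ) {y : XQuot Γ} {c : ℝ} (hc : 0 < c)
    (hy : rmul Γ y (umat c) = y) {ε : ℝ} (hε : 0 < ε) :
    ∀ᶠ g in 𝓝 (1 : SL2), ∀ t ≥ 0, |(∫ x in (0)..c, ψ (rmul Γ y (umat x * g * amat (-t)))) -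
      ∫ x in (0)..c, ψ (rmul Γ y (umat x * amat (-t)))| ≤ ε * c := by
  obtain ⟨δ, hδ, hW⟩ := SL2.exists_dev_lt_of_mem_nhds
    (eventually_forall_abs_rmul_sub_lt hcont hsupp hε)
  have hne : ∀ᶠ g in 𝓝 (1 : SL2), g 1 1 ≠ 0 :=
    (SL2.continuous_entry 1 1).continuousAt.eventually_ne (by simp)
  have hdev : ∀ᶠ g in 𝓝 (1 : SL2), SL2.dev (umat (-(g 0 1 / g 1 1)) * g) < δ := by
    have h : ContinuousAt (fun g : SL2 => SL2.dev (umat (-(g 0 1 / g 1 1)) * g)) 1 := by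
      refine SL2.continuous_dev.continuousAt.comp (ContinuousAt.mul
        (continuous_umat.continuousAt.comp (ContinuousAt.neg (ContinuousAt.div
          (SL2.continuous_entry 0 1).continuousAt (SL2.continuous_entry 1 1).continuousAt ?_)))
        continuousAt_id)
      simp
    exact h.eventually_lt continuousAt_const (by simpa [umat_zero, SL2.dev_one] using hδ)
  filter_upwards [hne, hdev] with g hg hgδ t ht
  set ℓ : SL2 := umat (-(g 0 1 / g 1 1)) * g with hℓ
  have hgℓ : g = umat (g 0 1 / g 1 1) * ℓ := by
    rw [hℓ, ← mul_assoc, ← umat_add, add_neg_cancel, umat_zero, one_mul]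
  have hℓ01 : ℓ 0 1 = 0 := by
    rw [hℓ]
    simp only [SL2.mul_entry, umat_entries]
    field_simp
    ring
  have hw : SL2.dev (amat t * ℓ * amat (-t)) < δ := by
    refine lt_of_le_of_lt ?_ hgδ
    have h := dev_amat_conj (-t) ℓ
    rw [neg_neg] at h
    rw [h, SL2.dev]
    have h1 : Real.exp (-t) * |ℓ 1 0| ≤ |ℓ 1 0| :=
      mul_le_of_le_one_left (abs_nonneg _) (Real.exp_le_one_iff.2 (by linarith))
    simp only [hℓ01, abs_zero, mul_zero, add_zero]
    linarith
  have hpt (x : ℝ) : |ψ (rmul Γ y (umat x * (ℓ * amat (-t)))) -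
      ψ (rmul Γ y (umat x * amat (-t)))| < ε := by
    have h := hW _ hw (rmul Γ y (umat x * amat (-t)))
    rw [rmul_rmul] at h
    convert h using 5
    rw [← amat_inv]
    group
  have e : ∫ x in (0)..c, ψ (rmul Γ y (umat x * g * amat (-t))) =
      ∫ x in (0)..c, ψ (rmul Γ y (umat x * (ℓ * amat (-t)))) := by
    rw [← integral_umat_mul_eq hy (g 0 1 / g 1 1), ← mul_assoc (umat (g 0 1 / g 1 1)), ← hgℓ]
    simp only [mul_assoc]
  have hii (h : SL2) : IntervalIntegrable (fun x => ψ (rmul Γ y (umat x * h))) volume 0 c :=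
    (hcont.comp (continuous_rmul_umat_mul y h)).intervalIntegrable _ _
  rw [e, ← intervalIntegral.integral_sub (hii _) (hii _)]
  have := intervalIntegral.norm_integral_le_of_norm_le_const (a := 0) (b := c) (C := ε)
    (f := fun x => ψ (rmul Γ y (umat x * (ℓ * amat (-t)))) - ψ (rmul Γ y (umat x * amat (-t))))
    fun x _ => (hpt x).le
  simpa [abs_of_pos hc] using this

/-- Expanding translates of a closed horocycle equidistribute. -/
theorem tendsto_integral_horocycle [T2Space (XQuot Γ)] {μ : Measure (XQuot Γ)}
    [IsProbabilityMeasure μ] [SMulInvariantMeasure SL2 (XQuot Γ) μ] (hcont : Continuous ψ)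
    (hsupp : HasCompactSupport ψ) {y : XQuot Γ} {c : ℝ} (hc : 0 < c)
    (hy : rmul Γ y (umat c) = y) :
    Tendsto (fun t => ∫ x in (0)..c, ψ (rmul Γ y (umat x * amat (-t)))) atTop
      (𝓝 (c * ∫ x, ψ x ∂μ)) := by
  rw [Metric.tendsto_atTop]
  intro ε hε
  obtain ⟨B, hB, hBsub, hBc⟩ := local_compact_nhds (eventually_abs_integral_horocycle_sub_le
    hcont hsupp hc hy (show 0 < ε / (2 * c) by positivity))
  obtain ⟨M, hM⟩ := hsupp.exists_bound_of_continuous hcont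
  set m : Measure SL2 := Measure.haar.restrict B with hm
  set l : Measure ℝ := volume.restrict (Set.Ioc 0 c) with hl
  have : IsFiniteMeasure m := ⟨by simpa [hm] using hBc.measure_lt_top⟩
  have hβ : 0 < m.real Set.univ := by
    rw [measureReal_def, ENNReal.toReal_pos_iff]
    refine ⟨?_, measure_lt_top _ _⟩
    simpa [hm] using Measure.measure_pos_of_mem_nhds (Measure.haar : Measure SL2) hB
  set β := m.real Set.univ with hβd
  have hF : Continuous fun p : ℝ × SL2 => rmul Γ y (umat p.1 * p.2) :=
    (continuous_rmul_right y).comp ((continuous_umat.comp continuous_fst).mul continuous_snd)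
  set η : Measure (XQuot Γ) := (l.prod m).map fun p : ℝ × SL2 => rmul Γ y (umat p.1 * p.2) with hη
  have : IsFiniteMeasure η := Measure.isFiniteMeasure_map _ _
  have hmass : η.real Set.univ = c * β := by
    rw [measureReal_def, hη, Measure.map_apply hF.measurable MeasurableSet.univ, Set.preimage_univ,
      ← Set.univ_prod_univ, Measure.prod_prod, ENNReal.toReal_mul]
    simp [hl, hβd, measureReal_def, hc.le]
  have hac : η ≪ μ := by
    refine Measure.AbsolutelyContinuous.mk fun A hA h0 => ?_
    rw [hη, Measure.map_apply hF.measurable hA, Measure.measure_prod_null (hF.measurable hA)]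
    refine Eventually.of_forall fun x => ?_
    refine Measure.absolutelyContinuous_of_le Measure.restrict_le_self ?_
    have := (measure_eq_zero_iff_haar hA (rmul Γ y (umat x))).1 h0
    simp only [rmul_rmul] at this
    exact this
  have hmix := tendsto_integral_rmul_amat (μ := μ) hac
    (BoundedContinuousFunction.ofNormedAddCommGroup ψ hcont M hM)
  obtain ⟨t₀, ht₀⟩ := Metric.tendsto_atTop.1 hmix (ε / 2 * β) (by positivity)
  refine ⟨max t₀ 0, fun t ht => ?_⟩
  have h1 := ht₀ t ((le_max_left _ _).trans ht)
  have hG : Continuous fun p : ℝ × SL2 => ψ (rmul Γ y (umat p.1 * p.2 * amat (-t))) :=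
    hcont.comp ((continuous_rmul_right y).comp
      (((continuous_umat.comp continuous_fst).mul continuous_snd).mul continuous_const))
  have hGi : Integrable (fun p : ℝ × SL2 => ψ (rmul Γ y (umat p.1 * p.2 * amat (-t)))) (l.prod m) :=
    (integrable_const M).mono' hG.aestronglyMeasurable (Eventually.of_forall fun p => hM _)
  have h2 : ∫ x, ψ (rmul Γ x (amat (-t))) ∂η =
      ∫ g, (∫ x in (0)..c, ψ (rmul Γ y (umat x * g * amat (-t)))) ∂m := by
    have hψt : Continuous fun x => ψ (rmul Γ x (amat (-t))) := hcont.comp (continuous_rmul_left _)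
    rw [hη, integral_map hF.measurable.aemeasurable hψt.aestronglyMeasurable]
    simp only [rmul_rmul, intervalIntegral.integral_of_le hc.le]
    exact integral_prod_symm _ hGi
  have h3 : |(∫ g, (∫ x in (0)..c, ψ (rmul Γ y (umat x * g * amat (-t)))) ∂m) -
      β * ∫ x in (0)..c, ψ (rmul Γ y (umat x * amat (-t)))| ≤ ε / 2 * β := by
    have hi : Integrable (fun g => ∫ x in (0)..c, ψ (rmul Γ y (umat x * g * amat (-t)))) m := by
      simp only [intervalIntegral.integral_of_le hc.le]
      exact hGi.integral_prod_right
    have e : β * ∫ x in (0)..c, ψ (rmul Γ y (umat x * amat (-t))) =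
        ∫ _, (∫ x in (0)..c, ψ (rmul Γ y (umat x * amat (-t)))) ∂m := by
      rw [integral_const, smul_eq_mul]
    rw [e, ← integral_sub hi (integrable_const _)]
    rw [← Real.norm_eq_abs]
    refine norm_integral_le_of_norm_le_const (C := ε / 2) (μ := m) ?_
    rw [hm, ae_restrict_iff' hBc.measurableSet]
    refine Eventually.of_forall fun g hg => ?_
    refine (hBsub hg t ((le_max_right _ _).trans ht)).trans (le_of_eq ?_)
    field_simp
  simp only [BoundedContinuousFunction.coe_ofNormedAddCommGroup, h2, hmass] at h1
  rw [Real.dist_eq] at h1 ⊢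
  have h4 : |β * (∫ x in (0)..c, ψ (rmul Γ y (umat x * amat (-t)))) -
      c * β * ∫ x, ψ x ∂μ| < ε * β := by
    rw [abs_lt] at h1 ⊢
    rw [abs_le] at h3
    constructor <;> linarith [h1.1, h1.2, h3.1, h3.2]
  rw [mul_comm c β, mul_assoc, ← mul_sub, abs_mul, abs_of_pos hβ, mul_comm] at h4
  exact lt_of_mul_lt_mul_right h4 hβ.le

end Horocycle

section Averaging

theorem abs_intervalIntegral_le {G : ℝ → ℝ} {M : ℝ} (hM : ∀ s, |G s| ≤ M) (a b : ℝ) :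
    |∫ s in a..b, G s| ≤ M * |b - a| := by
  rw [← Real.norm_eq_abs]
  exact intervalIntegral.norm_integral_le_of_norm_le_const fun s _ => hM s

theorem abs_integral_window_sub_le {G : ℝ → ℝ} (hG : Continuous G) {M : ℝ} (hM : ∀ s, |G s| ≤ M)
    {δ : ℝ} (hδ : 0 < δ) (L : ℝ) :
    |(∫ s in (0)..L, ∫ r in (0)..δ, G (s + r)) - δ * ∫ s in (0)..L, G s| ≤ 2 * M * δ ^ 2 := by
  have hi (a b : ℝ) : IntervalIntegrable G volume a b := hG.intervalIntegrable a b
  have hM0 : 0 ≤ M := (abs_nonneg _).trans (hM 0)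
  set Ψ : ℝ → ℝ := fun x => ∫ s in (0)..x, G s with hΨ
  have hΨc : Continuous Ψ := intervalIntegral.continuous_primitive hi 0
  have hΨi (a b : ℝ) : IntervalIntegrable Ψ volume a b := hΨc.intervalIntegrable a b
  have hsub (a b : ℝ) : Ψ b - Ψ a = ∫ s in a..b, G s :=
    intervalIntegral.integral_interval_sub_left (hi _ _) (hi _ _)
  have e1 (s : ℝ) : ∫ r in (0)..δ, G (s + r) = Ψ (s + δ) - Ψ s := by
    rw [intervalIntegral.integral_comp_add_left, add_zero, hsub]
  have e2 : ∫ s in (0)..L, (Ψ (s + δ) - Ψ s) = ∫ r in (0)..δ, (Ψ (L + r) - Ψ r) := by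
    rw [intervalIntegral.integral_sub, intervalIntegral.integral_sub,
      intervalIntegral.integral_comp_add_right, intervalIntegral.integral_comp_add_left,
      zero_add, add_zero]
    · have h1 := intervalIntegral.integral_add_adjacent_intervals (hΨi 0 δ) (hΨi δ (L + δ))
      have h2 := intervalIntegral.integral_add_adjacent_intervals (hΨi 0 L) (hΨi L (L + δ))
      linarith
    all_goals exact Continuous.intervalIntegrable (by fun_prop) _ _
  have e3 : δ * Ψ L = ∫ _ in (0)..δ, Ψ L := by simp
  simp only [e1]
  rw [e2, e3, ← intervalIntegral.integral_sub (Continuous.intervalIntegrable (by fun_prop) _ _)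
    (Continuous.intervalIntegrable (by fun_prop) _ _)]
  have h := intervalIntegral.norm_integral_le_of_norm_le_const (a := 0) (b := δ) (C := 2 * M * δ)
    (f := fun r => Ψ (L + r) - Ψ r - Ψ L) fun r hr => ?_
  · simpa [abs_of_pos hδ, sq, mul_assoc] using h
  · rw [Set.uIoc_of_le hδ.le] at hr
    have h1 := abs_intervalIntegral_le hM L (L + r)
    have h2 := abs_intervalIntegral_le hM 0 r
    rw [← hsub] at h1
    rw [← hsub] at h2
    have h3 : Ψ 0 = 0 := by simp [hΨ]
    rw [h3, sub_zero, sub_zero, abs_of_pos hr.1] at h2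
    rw [add_sub_cancel_left, abs_of_pos hr.1] at h1
    have h4 : M * r ≤ M * δ := mul_le_mul_of_nonneg_left hr.2 hM0
    rw [Real.norm_eq_abs, show Ψ (L + r) - Ψ r - Ψ L = (Ψ (L + r) - Ψ L) - Ψ r by ring]
    exact (abs_sub _ _).trans (by linarith)

theorem abs_integral_comp_mul_exp_le {φ : ℝ → ℝ} (hφ : Continuous φ) {M : ℝ} (hM : ∀ x, |φ x| ≤ M)
    {c : ℝ} (hc : 0 < c) (hper : Function.Periodic φ c) (h0 : ∫ x in (0)..c, φ x = 0)
    {δ : ℝ} (hδ : 0 < δ) (hδ1 : δ ≤ 1) (X : ℝ) :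
    |X| * |∫ r in (0)..δ, φ (X * Real.exp r)| ≤ 3 * (M * c) := by
  have hi (a b : ℝ) : IntervalIntegrable φ volume a b := hφ.intervalIntegrable a b
  have hM0 : 0 ≤ M := (abs_nonneg _).trans (hM 0)
  set Φ : ℝ → ℝ := fun x => ∫ s in (0)..x, φ s with hΦ
  have hΦc : Continuous Φ := intervalIntegral.continuous_primitive hi 0
  have hΦd (x : ℝ) : HasDerivAt Φ (φ x) x :=
    intervalIntegral.integral_hasDerivAt_right (hi _ _) (hφ.stronglyMeasurableAtFilter _ _)
      hφ.continuousAt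
  have hΦper : Function.Periodic Φ c := fun x => by
    have h := hper.intervalIntegral_add_eq x 0
    rw [zero_add, h0] at h
    have h2 := intervalIntegral.integral_add_adjacent_intervals (hi 0 x) (hi x (x + c))
    rw [h, add_zero] at h2
    exact h2.symm
  have hΦM (x : ℝ) : |Φ x| ≤ M * c := by
    obtain ⟨z, hz, hxz⟩ := hΦper.exists_mem_Ico₀ hc x
    rw [hxz]
    refine (abs_intervalIntegral_le hM 0 z).trans (mul_le_mul_of_nonneg_left ?_ hM0)
    rw [sub_zero, abs_of_nonneg hz.1]
    exact hz.2.le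
  have hder (r : ℝ) : HasDerivAt (fun r => Real.exp (-r) * Φ (X * Real.exp r))
      (X * φ (X * Real.exp r) - Real.exp (-r) * Φ (X * Real.exp r)) r := by
    have h1 : HasDerivAt (fun r => Φ (X * Real.exp r)) (φ (X * Real.exp r) * (X * Real.exp r)) r :=
      (hΦd _).comp r ((Real.hasDerivAt_exp r).const_mul X)
    have h2 : HasDerivAt (fun r => Real.exp (-r)) (-Real.exp (-r)) r := by
      simpa using (hasDerivAt_neg r).exp
    refine (h2.mul h1).congr_deriv ?_
    have : Real.exp (-r) * Real.exp r = 1 := by rw [← Real.exp_add]; simp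
    linear_combination (X * φ (X * Real.exp r)) * this
  have hint₀ := intervalIntegral.integral_eq_sub_of_hasDerivAt (a := 0) (b := δ)
    (fun r _ => hder r) (Continuous.intervalIntegrable (by fun_prop) _ _)
  rw [intervalIntegral.integral_sub (Continuous.intervalIntegrable (by fun_prop) _ _)
    (Continuous.intervalIntegrable (by fun_prop) _ _), intervalIntegral.integral_const_mul] at hint₀
  have hb : |∫ r in (0)..δ, Real.exp (-r) * Φ (X * Real.exp r)| ≤ M * c * |δ - 0| := by
    rw [← Real.norm_eq_abs]
    refine intervalIntegral.norm_integral_le_of_norm_le_const fun r hr => ?_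
    rw [Set.uIoc_of_le hδ.le] at hr
    rw [Real.norm_eq_abs, abs_mul, Real.abs_exp]
    exact (mul_le_of_le_one_left (abs_nonneg _) (Real.exp_le_one_iff.2 (by linarith [hr.1]))).trans
      (hΦM _)
  have hb2 : |Real.exp (-δ) * Φ (X * Real.exp δ)| ≤ M * c := by
    rw [abs_mul, Real.abs_exp]
    exact (mul_le_of_le_one_left (abs_nonneg _) (Real.exp_le_one_iff.2 (by linarith))).trans (hΦM _)
  have hb3 : |Real.exp (-0) * Φ (X * Real.exp 0)| ≤ M * c := by simpa using hΦM X
  rw [sub_zero, abs_of_pos hδ] at hb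
  have hMc : 0 ≤ M * c := by positivity
  have hb4 : M * c * δ ≤ M * c := mul_le_of_le_one_right hMc hδ1
  rw [← abs_mul]
  rw [abs_le] at *
  constructor <;> linarith [hb.1, hb.2, hb2.1, hb2.2, hb3.1, hb3.2]

/-- Continuous Cesàro means. -/
theorem tendsto_average_of_tendsto {n : ℝ → ℝ} (hn : Continuous n) {I : ℝ}
    (hI : Tendsto n atTop (𝓝 I)) (C : ℝ) :
    Tendsto (fun T => T⁻¹ * ∫ u in C..T, n u) atTop (𝓝 I) := by
  have hi (a b : ℝ) : IntervalIntegrable n volume a b := hn.intervalIntegrable a b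
  rw [Metric.tendsto_atTop] at hI ⊢
  intro ε hε
  obtain ⟨u₁, hu₁⟩ := hI (ε / 2) (by positivity)
  set u₀ := max u₁ 0 with hu₀
  set K : ℝ := |(∫ u in C..u₀, n u) - I * u₀| with hK
  refine ⟨max (max u₀ 1) (4 * K / ε), fun T hT => ?_⟩
  have hT1 : u₀ ≤ T := (le_max_left _ _).trans ((le_max_left _ _).trans hT)
  have hT2 : 1 ≤ T := (le_max_right _ _).trans ((le_max_left _ _).trans hT)
  have hT3 : 4 * K ≤ ε * T := by
    have := (le_max_right (max u₀ 1) _).trans hT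
    rwa [div_le_iff₀' hε] at this
  have hu0 : 0 ≤ u₀ := le_max_right _ _
  have h1 : |∫ u in u₀..T, (n u - I)| ≤ ε / 2 * |T - u₀| := by
    rw [← Real.norm_eq_abs]
    refine intervalIntegral.norm_integral_le_of_norm_le_const fun u hu => ?_
    rw [Set.uIoc_of_le hT1] at hu
    exact (hu₁ u ((le_max_left _ _).trans hu.1.le)).le
  rw [intervalIntegral.integral_sub (hi _ _) intervalIntegrable_const,
    intervalIntegral.integral_const, smul_eq_mul, abs_of_nonneg (sub_nonneg.2 hT1)] at h1
  have h2 := intervalIntegral.integral_add_adjacent_intervals (hi C u₀) (hi u₀ T)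
  have h3 : |(∫ u in C..T, n u) - I * T| < ε * T := by
    have hK1 := le_abs_self ((∫ u in C..u₀, n u) - I * u₀)
    have hK2 := neg_abs_le ((∫ u in C..u₀, n u) - I * u₀)
    rw [abs_le] at h1
    have : 0 ≤ ε * u₀ := by positivity
    have : 0 < ε * T := by positivity
    rw [abs_lt]
    constructor <;> nlinarith [h1.1, h1.2]
  have hT0 : 0 < T := by linarith
  rw [Real.dist_eq, show T⁻¹ * (∫ u in C..T, n u) - I = T⁻¹ * ((∫ u in C..T, n u) - I * T) by
    field_simp, abs_mul, abs_of_pos (inv_pos.2 hT0), inv_mul_lt_iff₀ hT0, mul_comm T]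
  exact h3

theorem continuous_integral_left {f : ℝ → ℝ → ℝ} (hf : Continuous (Function.uncurry f)) (a b : ℝ) :
    Continuous fun t => ∫ x in a..b, f x t :=
  intervalIntegral.continuous_parametric_intervalIntegral_of_continuous'
    (f := fun t x => f x t) (hf.comp continuous_swap) a b

theorem abs_integral_comp_mul_exp_sub_le {f : ℝ → ℝ → ℝ} (hf : Continuous (Function.uncurry f))
    {M : ℝ} (hM : ∀ x t, |f x t| ≤ M) {c : ℝ} (hc : 0 < c)
    (hper : ∀ t, Function.Periodic (fun x => f x t) c) {ε δ : ℝ} (hδ : 0 < δ) (hδ1 : δ ≤ 1)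
    (huc : ∀ r ∈ Set.Ioc 0 δ, ∀ x t, |f x (t + r) - f x t| ≤ ε) {α : ℝ} (hα : α ≠ 0)
    {L : ℝ} (hL : 0 ≤ L) (T : ℝ) :
    |(∫ s in (0)..L, f (α * Real.exp s) (s - T)) -
      ∫ s in (0)..L, c⁻¹ * ∫ x in (0)..c, f x (s - T)| ≤
      2 * M * δ + ε * L + 6 * M * c / |α| / δ := by
  have hM0 : 0 ≤ M := (abs_nonneg _).trans (hM 0 0)
  have hα' : 0 < |α| := abs_pos.2 hα
  set n : ℝ → ℝ := fun t => c⁻¹ * ∫ x in (0)..c, f x t with hn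
  have hnc : Continuous n := continuous_const.mul (continuous_integral_left hf 0 c)
  have hnM (t : ℝ) : |n t| ≤ M := by
    have h := abs_intervalIntegral_le (fun x => hM x t) 0 c
    rw [sub_zero, abs_of_pos hc] at h
    rw [hn]
    dsimp only
    rwa [abs_mul, abs_of_pos (inv_pos.2 hc), inv_mul_le_iff₀ hc, mul_comm c]
  set G : ℝ → ℝ := fun s => f (α * Real.exp s) (s - T) with hG
  have hGc : Continuous G := hf.comp
    ((continuous_const.mul Real.continuous_exp).prodMk (continuous_id.sub continuous_const))
  have hfx (t : ℝ) : Continuous fun x => f x t :=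
    hf.comp (continuous_id.prodMk continuous_const)
  have hwin := abs_integral_window_sub_le hGc (fun s => hM _ _) hδ L
  have hpt (s : ℝ) : |(∫ r in (0)..δ, G (s + r)) - δ * n (s - T)| ≤
      ε * δ + 6 * M * c / |α| * Real.exp (-s) := by
    have hc1 : Continuous fun r => f (α * Real.exp s * Real.exp r) (s - T) :=
      hf.comp ((continuous_const.mul Real.continuous_exp).prodMk continuous_const)
    have hc2 : Continuous fun r => G (s + r) := hGc.comp (continuous_const.add continuous_id)
    have e : (∫ r in (0)..δ, G (s + r)) - δ * n (s - T) =
        (∫ r in (0)..δ, (G (s + r) - f (α * Real.exp s * Real.exp r) (s - T))) +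
        ∫ r in (0)..δ, (f (α * Real.exp s * Real.exp r) (s - T) - n (s - T)) := by
      rw [intervalIntegral.integral_sub (hc2.intervalIntegrable _ _) (hc1.intervalIntegrable _ _),
        intervalIntegral.integral_sub (hc1.intervalIntegrable _ _) intervalIntegrable_const,
        intervalIntegral.integral_const, smul_eq_mul, sub_zero]
      ring
    have h1 : |∫ r in (0)..δ, (G (s + r) - f (α * Real.exp s * Real.exp r) (s - T))| ≤
        ε * |δ - 0| := by
      rw [← Real.norm_eq_abs]
      refine intervalIntegral.norm_integral_le_of_norm_le_const fun r hr => ?_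
      rw [Set.uIoc_of_le hδ.le] at hr
      have := huc r hr (α * Real.exp s * Real.exp r) (s - T)
      rw [Real.norm_eq_abs, hG]
      dsimp only
      rwa [Real.exp_add, ← mul_assoc, add_sub_right_comm]
    have h2 := abs_integral_comp_mul_exp_le (φ := fun x => f x (s - T) - n (s - T)) (M := 2 * M)
      ((hfx _).sub continuous_const)
      (fun x => (abs_sub _ _).trans (by linarith [hM x (s - T), hnM (s - T)])) hc
      ((hper _).sub fun x => rfl) (by
        rw [intervalIntegral.integral_sub ((hfx _).intervalIntegrable _ _)
          intervalIntegrable_const, intervalIntegral.integral_const, smul_eq_mul, sub_zero, hn]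
        field_simp
        simp) hδ hδ1 (α * Real.exp s)
    rw [abs_mul, Real.abs_exp] at h2
    rw [sub_zero, abs_of_pos hδ] at h1
    rw [e]
    refine (abs_add_le _ _).trans (add_le_add h1 ?_)
    rw [Real.exp_neg, div_mul_eq_mul_div, ← div_eq_mul_inv, div_div, le_div_iff₀ (by positivity)]
    linarith
  have hint₀ : |(∫ s in (0)..L, ∫ r in (0)..δ, G (s + r)) - δ * ∫ s in (0)..L, n (s - T)| ≤
      ε * δ * L + 6 * M * c / |α| := by
    have hc1 : Continuous fun s => ∫ r in (0)..δ, G (s + r) :=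
      continuous_integral_left (f := fun r s => G (s + r)) (hGc.comp (by fun_prop)) 0 δ
    have hc2 : Continuous fun s => δ * n (s - T) := by fun_prop
    rw [← intervalIntegral.integral_const_mul, ← intervalIntegral.integral_sub
      (hc1.intervalIntegrable _ _) (hc2.intervalIntegrable _ _), ← Real.norm_eq_abs]
    refine (intervalIntegral.norm_integral_le_of_norm_le hL
      (Eventually.of_forall fun s _ => hpt s)
      (Continuous.intervalIntegrable (by fun_prop) _ _)).trans ?_
    have e : ∫ s in (0)..L, Real.exp (-s) = 1 - Real.exp (-L) := by
      rw [intervalIntegral.integral_comp_neg]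
      simp
    rw [intervalIntegral.integral_add intervalIntegrable_const
      (Continuous.intervalIntegrable (by fun_prop) _ _), intervalIntegral.integral_const_mul,
      intervalIntegral.integral_const_mul, e, intervalIntegral.integral_const, smul_eq_mul,
      sub_zero]
    have h1 : 6 * M * c / |α| * (1 - Real.exp (-L)) ≤ 6 * M * c / |α| :=
      mul_le_of_le_one_right (by positivity) (by linarith [Real.exp_pos (-L)])
    linarith
  have hfin : |(∫ s in (0)..L, G s) - ∫ s in (0)..L, n (s - T)| * δ ≤
      2 * M * δ ^ 2 + ε * δ * L + 6 * M * c / |α| := by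
    rw [← abs_of_pos hδ, ← abs_mul, abs_of_pos hδ]
    rw [abs_le] at hwin hint₀ ⊢
    constructor <;> linarith [hwin.1, hwin.2, hint₀.1, hint₀.2]
  rw [← le_div_iff₀ hδ] at hfin
  refine hfin.trans (le_of_eq ?_)
  field_simp

theorem tendsto_average_comp_mul_exp {f : ℝ → ℝ → ℝ} (hf : Continuous (Function.uncurry f))
    {M : ℝ} (hM : ∀ x t, |f x t| ≤ M) {c : ℝ} (hc : 0 < c)
    (hper : ∀ t, Function.Periodic (fun x => f x t) c)
    (huc : ∀ ε > 0, ∀ᶠ r in 𝓝 (0 : ℝ), ∀ x t, |f x (t + r) - f x t| ≤ ε) {I : ℝ}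
    (hI : Tendsto (fun t => ∫ x in (0)..c, f x (-t)) atTop (𝓝 (c * I))) {α : ℝ} (hα : α ≠ 0)
    (C : ℝ) :
    Tendsto (fun T => T⁻¹ * ∫ s in (0)..(T + C), f (α * Real.exp s) (s - T)) atTop (𝓝 I) := by
  set n : ℝ → ℝ := fun t => c⁻¹ * ∫ x in (0)..c, f x t with hn
  have hnc : Continuous n := continuous_const.mul (continuous_integral_left hf 0 c)
  have h1 : Tendsto (fun T => T⁻¹ * ∫ s in (0)..(T + C), n (s - T)) atTop (𝓝 I) := by
    have h := tendsto_average_of_tendsto (n := fun u => n (-u)) (hnc.comp continuous_neg) (I := I)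
      (by
        have := hI.const_mul c⁻¹
        rwa [inv_mul_cancel_left₀ hc.ne'] at this) (-C)
    refine h.congr fun T => ?_
    rw [intervalIntegral.integral_comp_neg, intervalIntegral.integral_comp_sub_right]
    simp
  rw [Metric.tendsto_atTop] at h1 ⊢
  intro ε hε
  obtain ⟨T₁, hT₁⟩ := h1 (ε / 4) (by positivity)
  obtain ⟨δ₀, hδ₀, hball⟩ := Metric.eventually_nhds_iff.1 (huc (ε / 4) (by positivity))
  set δ := min (δ₀ / 2) 1 with hδd
  have hδ : 0 < δ := by positivity
  set K := 2 * M * δ + 6 * M * c / |α| / δ + ε / 4 * C with hK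
  refine ⟨max (max T₁ 1) (max (-C) (4 * K / ε)), fun T hT => ?_⟩
  have hT1 : T₁ ≤ T := (le_max_left _ _).trans ((le_max_left _ _).trans hT)
  have hT2 : 1 ≤ T := (le_max_right _ _).trans ((le_max_left _ _).trans hT)
  have hT3 : -C ≤ T := (le_max_left _ _).trans ((le_max_right _ _).trans hT)
  have hT4 : 4 * K ≤ ε * T := by
    have := (le_max_right (-C) _).trans ((le_max_right _ _).trans hT)
    rwa [div_le_iff₀' hε] at this
  have hT0 : 0 < T := by linarith
  have h2 := abs_integral_comp_mul_exp_sub_le hf hM hc hper hδ (min_le_right _ _) (ε := ε / 4)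
    (fun r hr x t => hball (by
      rw [dist_zero_right, Real.norm_of_nonneg hr.1.le]
      have := hr.2.trans (min_le_left _ _)
      linarith) x t) hα (show 0 ≤ T + C by linarith) T
  have h3 := hT₁ T hT1
  rw [Real.dist_eq] at h3 ⊢
  set A := ∫ s in (0)..(T + C), f (α * Real.exp s) (s - T) with hA
  change |A - ∫ s in (0)..(T + C), n (s - T)| ≤ _ at h2
  set B := ∫ s in (0)..(T + C), n (s - T) with hB
  have h4 : |T⁻¹ * A - T⁻¹ * B| ≤ ε / 2 := by
    rw [← mul_sub, abs_mul, abs_of_pos (inv_pos.2 hT0), inv_mul_le_iff₀ hT0]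
    refine h2.trans ?_
    linarith
  calc |T⁻¹ * A - I| ≤ |T⁻¹ * A - T⁻¹ * B| + |T⁻¹ * B - I| := abs_sub_le _ _ _
    _ < ε := by linarith

end Averaging

section HalfLine

variable {Γ : Subgroup SL2} {ψ : XQuot Γ → ℝ}

theorem hasCompactSupport_comp_rmul (hsupp : HasCompactSupport ψ) (g : SL2) :
    HasCompactSupport fun x => ψ (rmul Γ x g) := by
  have h := hsupp.comp_homeomorph (Homeomorph.smul g⁻¹ : XQuot Γ ≃ₜ XQuot Γ)
  have e : (ψ ∘ (Homeomorph.smul g⁻¹ : XQuot Γ ≃ₜ XQuot Γ)) = fun x => ψ (rmul Γ x g) := by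
    ext x
    simp [smul_eq_rmul]
  rwa [e] at h

theorem exists_bruhat {g : SL2} (hg : g 1 0 ≠ 0) :
    ∃ m : SL2, ∀ s T : ℝ, amat s * g * amat T =
      umat (g 0 0 / g 1 0 * Real.exp s) * amat (s - T) * m *
        umat (g 1 1 / g 1 0 * Real.exp (-T)) := by
  obtain ⟨p, hp⟩ : ∃ p, p = g 1 0 := ⟨_, rfl⟩
  rw [← hp] at hg ⊢
  set m : SL2 := ⟨!![0, -p⁻¹; p, 0], by simp [Matrix.det_fin_two_of, hg]⟩ with hm
  have m00 : m 0 0 = 0 := rfl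
  have m01 : m 0 1 = -p⁻¹ := rfl
  have m10 : m 1 0 = p := rfl
  have m11 : m 1 1 = 0 := rfl
  refine ⟨m, fun s T => ?_⟩
  have hdet : g 0 0 * g 1 1 - g 0 1 * p = 1 := by
    rw [hp, ← Matrix.det_fin_two]
    exact g.2
  have h1 : g = umat (g 0 0 / p) * m * umat (g 1 1 / p) := by
    obtain ⟨u00, u01, u10, u11⟩ := umat_entries (g 0 0 / p)
    obtain ⟨v00, v01, v10, v11⟩ := umat_entries (g 1 1 / p)
    rw [Matrix.SpecialLinearGroup.ext_iff]
    intro i j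
    fin_cases i <;> fin_cases j <;>
      simp only [Fin.zero_eta, Fin.mk_one, SL2.mul_entry, u00, u01, u10, u11, v00, v01, v10, v11,
        m00, m01, m10, m11, ← hp] <;> field_simp <;> linarith
  have h2 : m * amat T = amat (-T) * m := by
    obtain ⟨u00, u01, u10, u11⟩ := amat_entries T
    obtain ⟨v00, v01, v10, v11⟩ := amat_entries (-T)
    rw [Matrix.SpecialLinearGroup.ext_iff]
    intro i j
    fin_cases i <;> fin_cases j <;>
      simp only [Fin.zero_eta, Fin.mk_one, SL2.mul_entry, u00, u01, u10, u11, v00, v01, v10, v11,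
        m00, m01, m10, m11, neg_div, neg_neg] <;> ring
  have h3 : amat s * umat (g 0 0 / p) = umat (g 0 0 / p * Real.exp s) * amat s := by
    have := amat_conj_umat (-s) (g 0 0 / p)
    rw [neg_neg, ← amat_inv, mul_inv_eq_iff_eq_mul] at this
    rw [this, mul_comm]
  have h4 : umat (g 1 1 / p) * amat T = amat T * umat (g 1 1 / p * Real.exp (-T)) := by
    have := amat_conj_umat T (g 1 1 / p)
    rw [← amat_inv, mul_assoc, inv_mul_eq_iff_eq_mul] at this
    rw [this, mul_comm (Real.exp (-T))]
  calc amat s * g * amat T = amat s * (umat (g 0 0 / p) * m * umat (g 1 1 / p)) * amat T := by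
        rw [← h1]
    _ = (amat s * umat (g 0 0 / p)) * m * (umat (g 1 1 / p) * amat T) := by simp only [mul_assoc]
    _ = umat (g 0 0 / p * Real.exp s) * amat s * (m * amat T) *
        umat (g 1 1 / p * Real.exp (-T)) := by rw [h3, h4]; simp only [mul_assoc]
    _ = _ := by rw [h2, sub_eq_add_neg, amat_add]; simp only [mul_assoc]

theorem eventually_forall_rmul_umat_mul_amat_notMem [DiscreteTopology Γ] {y : XQuot Γ} {c : ℝ}
    (hc : c ≠ 0) (hy : rmul Γ y (umat c) = y) {K : Set (XQuot Γ)} (hK : IsCompact K) :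
    ∀ᶠ t in atTop, ∀ x, rmul Γ y (umat x * amat t) ∉ K := by
  have h1 := hK.eventually_forall_of_forall_eventually (x₀ := (1 : SL2))
    (P := fun w x => rmul Γ x w = x → w = 1) fun x _ => by
      have := eventually_eq_one_of_rmul_eq x
      rw [← nhds_prod_eq] at this
      exact (continuous_swap.tendsto ((1 : SL2), x)).eventually this
  have h2 : Tendsto (fun t => umat (Real.exp (-t) * c)) atTop (𝓝 1) := by
    rw [← umat_zero]
    refine (continuous_umat.tendsto 0).comp ?_
    have := (Real.tendsto_exp_neg_atTop_nhds_zero).mul_const c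
    rwa [zero_mul] at this
  filter_upwards [h2.eventually h1] with t ht x hx
  have h3 := ht _ hx (by
    rw [rmul_rmul, ← amat_conj_umat, ← amat_inv, show umat x * amat t *
      ((amat t)⁻¹ * umat c * amat t) = umat c * (umat x * amat t) by
        rw [← mul_assoc (umat c), ← umat_add, add_comm c, umat_add]; group, ← rmul_rmul, hy])
  have h4 := congrArg (fun g : SL2 => g 0 1) h3
  simp [(umat_entries _).2.1, hc] at h4

theorem tendsto_average_rmul_amat [T2Space (XQuot Γ)] [DiscreteTopology Γ]
    {μ : Measure (XQuot Γ)} [IsProbabilityMeasure μ] [SMulInvariantMeasure SL2 (XQuot Γ) μ]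
    (hcont : Continuous ψ) (hsupp : HasCompactSupport ψ) {y : XQuot Γ} {c : ℝ} (hc : 0 < c)
    (hy : rmul Γ y (umat c) = y) {g : SL2} (hg0 : g 0 0 ≠ 0) (hg1 : g 1 0 ≠ 0) :
    (∀ᶠ T in atTop, IntegrableOn (fun s => ψ (rmul Γ y (amat s * g * amat T))) (Set.Ioi 0)) ∧
    Tendsto (fun T => T⁻¹ * ∫ s in Set.Ioi 0, ψ (rmul Γ y (amat s * g * amat T))) atTop
      (𝓝 (∫ x, ψ x ∂μ)) := by
  obtain ⟨m, hm⟩ := exists_bruhat hg1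
  set α := g 0 0 / g 1 0 with hα
  set b : ℝ → ℝ := fun T => g 1 1 / g 1 0 * Real.exp (-T) with hb
  replace hm (s T : ℝ) : amat s * g * amat T =
      umat (α * Real.exp s) * amat (s - T) * m * umat (b T) := hm s T
  have hb0 : Tendsto (fun T => umat (b T)) atTop (𝓝 1) := by
    rw [← umat_zero]
    refine (continuous_umat.tendsto 0).comp ?_
    have := (Real.tendsto_exp_neg_atTop_nhds_zero).const_mul (g 1 1 / g 1 0)
    rwa [mul_zero] at this
  set ψm : XQuot Γ → ℝ := fun x => ψ (rmul Γ x m) with hψm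
  have hmc : Continuous ψm := hcont.comp (continuous_rmul_left m)
  have hms : HasCompactSupport ψm := hasCompactSupport_comp_rmul hsupp m
  have hmi : ∫ x, ψm x ∂μ = ∫ x, ψ x ∂μ :=
    (measurePreserving_rmul m).integral_comp (measurableEmbedding_rmul m) ψ
  obtain ⟨M, hM⟩ := hms.exists_bound_of_continuous hmc
  set f : ℝ → ℝ → ℝ := fun x t => ψm (rmul Γ y (umat x * amat t)) with hf
  have hfc : Continuous (Function.uncurry f) :=
    hmc.comp ((continuous_rmul_right y).comp ((continuous_umat.comp continuous_fst).mul
      (continuous_amat.comp continuous_snd)))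
  have hFc (T : ℝ) : Continuous fun s => ψ (rmul Γ y (amat s * g * amat T)) :=
    hcont.comp ((continuous_rmul_right y).comp
      ((continuous_amat.mul continuous_const).mul continuous_const))
  have hFf (s T : ℝ) : ψ (rmul Γ y (amat s * g * amat T)) =
      ψ (rmul Γ (rmul Γ (rmul Γ y (umat (α * Real.exp s) * amat (s - T))) m) (umat (b T))) := by
    rw [hm, rmul_rmul, rmul_rmul, mul_assoc _ m]
  obtain ⟨V, hV, -, hVc⟩ := local_compact_nhds (univ_mem : Set.univ ∈ 𝓝 (1 : SL2))
  have hK : IsCompact ((fun p : XQuot Γ × SL2 => rmul Γ p.1 p.2) ''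
      (tsupport ψ ×ˢ ((fun v => v⁻¹ * m⁻¹) '' V))) :=
    (IsCompact.prod hsupp (hVc.image (by fun_prop))).image continuous_rmul
  obtain ⟨C, hC⟩ := eventually_atTop.1 (eventually_forall_rmul_umat_mul_amat_notMem hc.ne' hy hK)
  have hzero : ∀ᶠ T in atTop, ∀ s, T + C ≤ s → ψ (rmul Γ y (amat s * g * amat T)) = 0 := by
    filter_upwards [hb0 hV] with T hT s hs
    by_contra h
    refine hC (s - T) (by linarith) (α * Real.exp s)
      ⟨(rmul Γ y (amat s * g * amat T), (umat (b T))⁻¹ * m⁻¹),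
        ⟨subset_tsupport ψ h, ⟨_, hT, rfl⟩⟩, ?_⟩
    dsimp only
    rw [rmul_rmul, hm]
    congr 1
    group
  have hzero' : ∀ᶠ T in atTop, ∀ s ∈ Set.Ioi (0 : ℝ) \ Set.Ioc 0 (T + C),
      ψ (rmul Γ y (amat s * g * amat T)) = 0 := by
    filter_upwards [hzero] with T hT s hs
    refine hT s ?_
    by_contra! h
    exact hs.2 ⟨hs.1, h.le⟩
  refine ⟨?_, ?_⟩
  · filter_upwards [hzero'] with T hT
    exact ((hFc T).integrableOn_Ioc (a := 0) (b := T + C)).of_forall_sdiff_eq_zero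
      measurableSet_Ioi hT
  have h1 := tendsto_average_comp_mul_exp hfc (fun x t => hM _) hc
    (fun t => (rmul_umat_mul_periodic hy (amat t)).comp ψm)
    (fun ε hε => by
      have h := (continuous_amat.tendsto 0)
      rw [amat_zero] at h
      filter_upwards [h.eventually (eventually_forall_abs_rmul_sub_lt hmc hms hε)] with r hr x t
      have := hr (rmul Γ y (umat x * amat t))
      rw [rmul_rmul, mul_assoc, ← amat_add] at this
      exact this.le)
    (tendsto_integral_horocycle (μ := μ) hmc hms hc hy) (div_ne_zero hg0 hg1) C
  rw [hmi] at h1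
  rw [Metric.tendsto_atTop'] at h1 ⊢
  intro ε hε
  obtain ⟨T₁, hT₁⟩ := h1 (ε / 2) (by positivity)
  obtain ⟨T₂, hT₂⟩ := eventually_atTop.1 (hzero'.and
    (hb0.eventually (eventually_forall_abs_rmul_sub_lt hcont hsupp
      (show 0 < ε / 4 by positivity))))
  refine ⟨max (max T₁ T₂) (max 1 |C|), fun T hT => ?_⟩
  simp only [max_lt_iff, gt_iff_lt] at hT
  obtain ⟨⟨hT1, hT2⟩, hT3, hT4⟩ := hT
  obtain ⟨hz, hw⟩ := hT₂ T hT2.le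
  have hT0 : 0 < T := by linarith
  have hC1 := le_abs_self C
  have hC2 := neg_abs_le C
  have e : ∫ s in Set.Ioi 0, ψ (rmul Γ y (amat s * g * amat T)) =
      ∫ s in (0)..(T + C), ψ (rmul Γ y (amat s * g * amat T)) := by
    rw [intervalIntegral.integral_of_le (by linarith)]
    exact setIntegral_eq_of_subset_of_forall_sdiff_eq_zero measurableSet_Ioi
      Set.Ioc_subset_Ioi_self hz
  have hfs : Continuous fun s => f (α * Real.exp s) (s - T) :=
    hmc.comp ((continuous_rmul_right y).comp
      ((continuous_umat.comp (continuous_const.mul Real.continuous_exp)).mul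
        (continuous_amat.comp (continuous_id.sub continuous_const))))
  have h2 : |(∫ s in (0)..(T + C), ψ (rmul Γ y (amat s * g * amat T))) -
      ∫ s in (0)..(T + C), f (α * Real.exp s) (s - T)| ≤ ε / 4 * (T + C) := by
    have h := intervalIntegral.norm_integral_le_of_norm_le_const (a := 0) (b := T + C)
      (f := fun s => ψ (rmul Γ y (amat s * g * amat T)) - f (α * Real.exp s) (s - T))
      (C := ε / 4) fun s _ => by
        rw [hFf]
        exact (hw _).le
    rwa [intervalIntegral.integral_sub ((hFc T).intervalIntegrable _ _)
      (hfs.intervalIntegrable _ _), Real.norm_eq_abs, sub_zero,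
      abs_of_nonneg (by linarith : (0 : ℝ) ≤ T + C)] at h
  have h3 := hT₁ T hT1
  rw [e]
  rw [Real.dist_eq] at h3 ⊢
  have h4 : |T⁻¹ * (∫ s in (0)..(T + C), ψ (rmul Γ y (amat s * g * amat T))) -
      T⁻¹ * ∫ s in (0)..(T + C), f (α * Real.exp s) (s - T)| ≤ ε / 2 := by
    rw [← mul_sub, abs_mul, abs_of_pos (inv_pos.2 hT0), inv_mul_le_iff₀ hT0]
    refine h2.trans ?_
    nlinarith
  exact (abs_sub_le _ _ _).trans_lt (by linarith)

end HalfLine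

section ClosedOrbit

theorem isClosedEmbedding_vadd_of_isClosed_orbit {X : Type*} [TopologicalSpace X] [T2Space X]
    [LocallyCompactSpace X] [AddAction ℝ X] [ContinuousVAdd ℝ X] {x : X}
    (hcl : IsClosed (AddAction.orbit ℝ x)) (hnc : ¬ IsCompact (AddAction.orbit ℝ x)) :
    IsClosedEmbedding fun t : ℝ => t +ᵥ x := by
  have hc : Continuous fun t : ℝ => t +ᵥ x := continuous_id.vadd continuous_const
  have hinj : Function.Injective fun t : ℝ => t +ᵥ x := by
    intro s t hst
    by_contra h
    refine hnc (Function.Periodic.compact_of_continuous (c := s - t) (f := fun t : ℝ => t +ᵥ x)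
      (fun r => ?_) (sub_ne_zero.2 h) hc)
    dsimp only at hst ⊢
    rw [show r + (s - t) = (r - t) + s by ring, add_vadd, hst, ← add_vadd, sub_add_cancel]
  have : LocallyCompactSpace (AddAction.orbit ℝ x) :=
    hcl.isClosedEmbedding_subtypeVal.locallyCompactSpace
  have : ContinuousVAdd ℝ (AddAction.orbit ℝ x) :=
    ⟨Continuous.subtype_mk (continuous_fst.vadd (continuous_subtype_val.comp continuous_snd)) _⟩
  have ho := isOpenMap_vadd_of_sigmaCompact (G := ℝ)
    (⟨x, AddAction.mem_orbit_self x⟩ : AddAction.orbit ℝ x)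
  have hoe : IsOpenEmbedding fun t : ℝ =>
      t +ᵥ (⟨x, AddAction.mem_orbit_self x⟩ : AddAction.orbit ℝ x) :=
    IsOpenEmbedding.of_continuous_injective_isOpenMap (continuous_id.vadd continuous_const)
      (fun s t hst => hinj (congrArg Subtype.val hst)) ho
  exact ⟨IsEmbedding.subtypeVal.comp hoe.isEmbedding, hcl⟩

end ClosedOrbit

section Geodesic

variable {Γ : Subgroup SL2} {ψ : XQuot Γ → ℝ}

theorem hmat_entries (s : ℝ) : hmat s 0 0 = Real.cosh (s / 2) ∧ hmat s 0 1 = Real.sinh (s / 2) ∧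
    hmat s 1 0 = Real.sinh (s / 2) ∧ hmat s 1 1 = Real.cosh (s / 2) :=
  ⟨rfl, rfl, rfl, rfl⟩

theorem continuous_hmat : Continuous hmat := by
  rw [SL2.continuous_iff_entry]
  intro i j
  fin_cases i <;> fin_cases j <;> simp [hmat_entries] <;> fun_prop

/-- A matrix conjugating the diagonal subgroup to the subgroup of hyperbolic rotations. -/
def kmat : SL2 := ⟨!![1, -(1 / 2); 1, 1 / 2], by norm_num [Matrix.det_fin_two_of]⟩

/-- The Weyl element. -/
def wmat : SL2 := ⟨!![0, -1; 1, 0], by norm_num [Matrix.det_fin_two_of]⟩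

theorem kmat_entries : kmat 0 0 = 1 ∧ kmat 0 1 = -(1 / 2) ∧ kmat 1 0 = 1 ∧ kmat 1 1 = 1 / 2 :=
  ⟨rfl, rfl, rfl, rfl⟩

theorem wmat_entries : wmat 0 0 = 0 ∧ wmat 0 1 = -1 ∧ wmat 1 0 = 1 ∧ wmat 1 1 = 0 :=
  ⟨rfl, rfl, rfl, rfl⟩

theorem SL2.inv_entries (g : SL2) :
    g⁻¹ 0 0 = g 1 1 ∧ g⁻¹ 0 1 = -g 0 1 ∧ g⁻¹ 1 0 = -g 1 0 ∧ g⁻¹ 1 1 = g 0 0 := by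
  rw [Matrix.SpecialLinearGroup.SL2_inv_expl]
  exact ⟨rfl, rfl, rfl, rfl⟩

theorem hmat_eq_conj (s : ℝ) : hmat s = kmat * amat s * kmat⁻¹ := by
  obtain ⟨a00, a01, a10, a11⟩ := amat_entries s
  obtain ⟨h00, h01, h10, h11⟩ := hmat_entries s
  obtain ⟨k00, k01, k10, k11⟩ := kmat_entries
  obtain ⟨i00, i01, i10, i11⟩ := SL2.inv_entries kmat
  rw [Matrix.SpecialLinearGroup.ext_iff]
  intro i j
  fin_cases i <;> fin_cases j <;>
    simp only [Fin.zero_eta, Fin.mk_one, SL2.mul_entry, a00, a01, a10, a11, h00, h01, h10, h11,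
      k00, k01, k10, k11, i00, i01, i10, i11, Real.cosh_eq, Real.sinh_eq] <;> ring

theorem amat_neg_eq_conj (t : ℝ) : amat (-t) = wmat * amat t * wmat⁻¹ := by
  obtain ⟨a00, a01, a10, a11⟩ := amat_entries t
  obtain ⟨b00, b01, b10, b11⟩ := amat_entries (-t)
  obtain ⟨w00, w01, w10, w11⟩ := wmat_entries
  obtain ⟨i00, i01, i10, i11⟩ := SL2.inv_entries wmat
  rw [Matrix.SpecialLinearGroup.ext_iff]
  intro i j
  fin_cases i <;> fin_cases j <;>
    simp only [Fin.zero_eta, Fin.mk_one, SL2.mul_entry, a00, a01, a10, a11, b00, b01, b10, b11,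
      w00, w01, w10, w11, i00, i01, i10, i11, neg_div] <;> ring_nf

theorem hmat_neg_eq_conj (s : ℝ) : hmat (-s) = (kmat * wmat) * amat s * (kmat * wmat)⁻¹ := by
  rw [hmat_eq_conj, amat_neg_eq_conj, _root_.mul_inv_rev]
  simp only [mul_assoc]

theorem hmat_add (s t : ℝ) : hmat (s + t) = hmat s * hmat t := by
  simp only [hmat_eq_conj, amat_add]
  group

theorem isClosedEmbedding_rmul_hmat [T2Space (XQuot Γ)] {x : XQuot Γ}
    (hcl : IsClosed (Set.range fun s : ℝ => rmul Γ x (hmat s)))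
    (hnc : ¬ IsCompact (Set.range fun s : ℝ => rmul Γ x (hmat s))) :
    IsClosedEmbedding fun s : ℝ => rmul Γ x (hmat s) := by
  let _ : AddAction ℝ (XQuot Γ) :=
    { vadd := fun s x => rmul Γ x (hmat s)
      zero_vadd := fun x => by
        change rmul Γ x (hmat 0) = x
        rw [hmat_eq_conj, amat_zero, mul_one, mul_inv_cancel, rmul_one]
      add_vadd := fun s t x => by
        change rmul Γ x (hmat (s + t)) = rmul Γ (rmul Γ x (hmat t)) (hmat s)
        rw [rmul_rmul, add_comm, hmat_add] }
  have : ContinuousVAdd ℝ (XQuot Γ) :=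
    ⟨continuous_rmul.comp (continuous_snd.prodMk (continuous_hmat.comp continuous_fst))⟩
  exact isClosedEmbedding_vadd_of_isClosed_orbit hcl hnc

theorem tendsto_average_of_conj_amat (hlat : IsLatticeSL2 Γ) [T2Space (XQuot Γ)]
    {μ : Measure (XQuot Γ)} [IsProbabilityMeasure μ] [SMulInvariantMeasure SL2 (XQuot Γ) μ]
    (hcont : Continuous ψ) (hsupp : HasCompactSupport ψ) {x : XQuot Γ} {η : ℝ → SL2}
    (hη : Tendsto (fun s => rmul Γ x (η s)) atTop (cocompact (XQuot Γ))) {κ : SL2}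
    (hκ : ∀ s, η s = κ * amat s * κ⁻¹) {v : SL2} (hv0 : (κ⁻¹ * v) 0 0 ≠ 0)
    (hv1 : (κ⁻¹ * v) 1 0 ≠ 0) :
    (∀ᶠ T in atTop, IntegrableOn (fun s => ψ (rmul Γ x (η s * v * amat T))) (Set.Ioi 0)) ∧
    Tendsto (fun T => T⁻¹ * ∫ s in Set.Ioi 0, ψ (rmul Γ x (η s * v * amat T))) atTop
      (𝓝 (∫ z, ψ z ∂μ)) := by
  have := hlat.1
  have hcusp : Tendsto (fun s => rmul Γ (rmul Γ x κ) (amat s)) atTop (cocompact (XQuot Γ)) := by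
    have h1 := (Homeomorph.smul κ⁻¹ : XQuot Γ ≃ₜ
      XQuot Γ).isClosedEmbedding.tendsto_cocompact.comp hη
    refine h1.congr fun s => ?_
    simp only [Function.comp_apply, Homeomorph.smul_apply, smul_eq_rmul, inv_inv, rmul_rmul, hκ,
      inv_mul_cancel_right]
  obtain ⟨c, hc, hy⟩ := exists_umat_stabilizer hlat hcusp
  have h := tendsto_average_rmul_amat (μ := μ) hcont hsupp hc hy hv0 hv1
  have e (s T : ℝ) : rmul Γ (rmul Γ x κ) (amat s * (κ⁻¹ * v) * amat T) =
      rmul Γ x (η s * v * amat T) := by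
    rw [rmul_rmul, hκ]
    simp only [mul_assoc]
  simpa only [e] using h

theorem tendsto_average_hmat (hlat : IsLatticeSL2 Γ) [T2Space (XQuot Γ)]
    {μ : Measure (XQuot Γ)} [IsProbabilityMeasure μ] [SMulInvariantMeasure SL2 (XQuot Γ) μ]
    (hcont : Continuous ψ) (hsupp : HasCompactSupport ψ) {x : XQuot Γ}
    (hx : IsClosedEmbedding fun s : ℝ => rmul Γ x (hmat s)) {v : SL2}
    (hv0 : (kmat⁻¹ * v) 0 0 ≠ 0) (hv1 : (kmat⁻¹ * v) 1 0 ≠ 0) :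
    Tendsto (fun T => (1 / (2 * |T|)) * ∫ s, ψ (rmul Γ x (hmat s * v * amat T))) atTop
      (𝓝 (∫ z, ψ z ∂μ)) := by
  have h1 := hx.tendsto_cocompact.mono_left (atTop_le_cocompact (α := ℝ))
  have h2 := (hx.tendsto_cocompact.mono_left (atBot_le_cocompact (α := ℝ))).comp
    tendsto_neg_atTop_atBot
  obtain ⟨hi1, ht1⟩ := tendsto_average_of_conj_amat (μ := μ) hlat hcont hsupp h1 hmat_eq_conj
    hv0 hv1
  have hw (j : Fin 2) : ((kmat * wmat)⁻¹ * v) 0 j = (kmat⁻¹ * v) 1 j ∧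
      ((kmat * wmat)⁻¹ * v) 1 j = - (kmat⁻¹ * v) 0 j := by
    obtain ⟨w00, w01, w10, w11⟩ := wmat_entries
    obtain ⟨i00, i01, i10, i11⟩ := SL2.inv_entries wmat
    rw [_root_.mul_inv_rev, mul_assoc, SL2.mul_entry wmat⁻¹, SL2.mul_entry wmat⁻¹, i00, i01, i10,
      i11, w00, w01, w10, w11]
    constructor <;> ring
  obtain ⟨hi2, ht2⟩ := tendsto_average_of_conj_amat (μ := μ) hlat hcont hsupp
    (η := fun s => hmat (-s)) h2 hmat_neg_eq_conj (v := v) (by rwa [(hw 0).1])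
    (by rwa [(hw 0).2, neg_ne_zero])
  have h3 := (ht1.add ht2).const_mul (1 / 2)
  rw [show 1 / 2 * ((∫ z, ψ z ∂μ) + ∫ z, ψ z ∂μ) = ∫ z, ψ z ∂μ by ring] at h3
  refine h3.congr' ?_
  filter_upwards [hi1, hi2, eventually_gt_atTop 0] with T h4 h5 hT
  have h6 : IntegrableOn (fun s => ψ (rmul Γ x (hmat s * v * amat T))) (Set.Iic 0) := by
    rw [integrableOn_Iic_iff_integrableOn_Iio, ← (Measure.measurePreserving_neg
      (volume : Measure ℝ)).integrableOn_comp_preimage (Homeomorph.neg ℝ).measurableEmbedding]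
    simpa [Function.comp_def] using h5
  have h7 := integral_comp_neg_Ioi 0 fun s => ψ (rmul Γ x (hmat s * v * amat T))
  rw [neg_zero] at h7
  rw [← intervalIntegral.integral_Iic_add_Ioi h6 h4, abs_of_pos hT, h7]
  field_simp
  ring

end Geodesic

/-- equidistribution of orthogonal translates of a closed non-compact geodesic. -/
theorem translates_of_closed_noncompact_geodesic
    (Γ : Subgroup SL2) (hlat : IsLatticeSL2 Γ)
    (hnonuniform : ¬ IsCompact (Set.univ : Set (XQuot Γ)))
    (μ : Measure (XQuot Γ)) (hprob : IsProbabilityMeasure μ)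
    (hinv : ∀ g : SL2, Measure.map (fun x => rmul Γ x g) μ = μ)
    (x₀ : XQuot Γ)
    (hclosed : IsClosed (Set.range fun s : ℝ => rmul Γ x₀ (hmat s)))
    (hnoncpt : ¬ IsCompact (Set.range fun s : ℝ => rmul Γ x₀ (hmat s)))
    (ψ : XQuot Γ → ℝ) (hcont : Continuous ψ) (hsupp : HasCompactSupport ψ) :
    Tendsto (fun T : ℝ => (1 / (2 * |T|)) * ∫ s : ℝ, ψ (rmul Γ x₀ (hmat s * amat T)))
        atTop (𝓝 (∫ x, ψ x ∂μ)) ∧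
    Tendsto (fun T : ℝ => (1 / (2 * |T|)) * ∫ s : ℝ, ψ (rmul Γ x₀ (hmat s * amat T)))
        atBot (𝓝 (∫ x, ψ x ∂μ)) := by
  have := hlat.1
  have := t2Space_xQuot (Γ := Γ)
  have := smulInvariantMeasure_xQuot hinv
  have hx := isClosedEmbedding_rmul_hmat hclosed hnoncpt
  obtain ⟨k00, k01, k10, k11⟩ := kmat_entries
  obtain ⟨w00, w01, w10, w11⟩ := wmat_entries
  obtain ⟨i00, i01, i10, i11⟩ := SL2.inv_entries kmat
  refine ⟨?_, ?_⟩
  · have h := tendsto_average_hmat (μ := μ) hlat hcont hsupp hx (v := 1)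
      (by rw [mul_one, i00, k11]; norm_num) (by rw [mul_one, i10, k10]; norm_num)
    simpa only [mul_one] using h
  · have h := (tendsto_average_hmat (μ := μ) hlat (hcont.comp (continuous_rmul_left wmat⁻¹))
      (hasCompactSupport_comp_rmul hsupp wmat⁻¹) hx (v := wmat)
      (by rw [SL2.mul_entry, i00, i01, w00, w10, k01, k11]; norm_num)
      (by rw [SL2.mul_entry, i10, i11, w00, w10, k00, k10]; norm_num)).comp tendsto_neg_atBot_atTop
    have e : ∫ z, ψ (rmul Γ z wmat⁻¹) ∂μ = ∫ z, ψ z ∂μ :=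
      (measurePreserving_rmul wmat⁻¹).integral_comp (measurableEmbedding_rmul wmat⁻¹) ψ
    rw [← e]
    refine h.congr fun T => ?_
    have e' (s : ℝ) : hmat s * wmat * amat (-T) * wmat⁻¹ = hmat s * amat T := by
      have := amat_neg_eq_conj (-T)
      rw [neg_neg] at this
      rw [this]
      simp only [mul_assoc]
    simp only [Function.comp_apply, rmul_rmul, e', abs_neg]
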